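/- Fix a prime p and constant k ≥ 1. For a k-multipartition μ of N, let μ̃ be the k-multipartition obtained by repeatedly replacing, in each component, p parts of equal size m by one part of size mp, until no component has a part appearing p or more times. Then except for O(exp(−(N/k)^{1/(15p)}) · p_k(N)) multipartitions μ of N, the largest part of μ̃ is at least (√6/(2π)) · √(N/k) · log(N/k) · (1 + 1/(5p)). -/

import Mathlib

open Real

/-- A `k`-multipartition of `N`: a `k`-tuple of partitions whose sizes sum to `N`. -/
def Multipartition (k N : ℕ) : Type :=
  { μ : Fin k → Σ n : ℕ, n.Partition // (∑ i, (μ i).1) = N }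

/-- One mashing step: in some component, replace `p` parts of equal size `m`
by a single part of size `m·p`. -/
def MergeStep {k : ℕ} (p : ℕ) (a b : Fin k → Multiset ℕ) : Prop :=
  ∃ j m, 0 < m ∧ Multiset.replicate p m ≤ a j ∧
    b j = (a j - Multiset.replicate p m) + {m * p} ∧ ∀ i, i ≠ j → b i = a i

/-- A multipartition is fully mashed (this is `μ̃`) if no part appears `p` or more times
in any component. -/
def FullyMashed {k : ℕ} (p : ℕ) (ν : Fin k → Multiset ℕ) : Prop :=
  ∀ i, ∀ m : ℕ, (ν i).count m < p

/-- The largest part of a multipartition (given componentwise as multisets of parts). -/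
def maxPart {k : ℕ} (ν : Fin k → Multiset ℕ) : ℕ :=
  Finset.univ.sup fun i => (ν i).sup

open Classical in
/-- The total size of the parts of `s` of the form `m * p ^ j`. -/
noncomputable def powSum (p m : ℕ) (s : Multiset ℕ) : ℕ :=
  (s.filter fun i => ∃ j, i = m * p ^ j).sum

lemma powSum_add (p m : ℕ) (s t : Multiset ℕ) :
    powSum p m (s + t) = powSum p m s + powSum p m t := by
  simp [powSum]

lemma powSum_merge_le {p : ℕ} (m i : ℕ) :
    powSum p m (Multiset.replicate p i) ≤ powSum p m {i * p} := by
  classical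
  unfold powSum
  by_cases h : ∃ j, i = m * p ^ j
  · have h' : ∃ j, i * p = m * p ^ j := by
      obtain ⟨j, rfl⟩ := h
      exact ⟨j + 1, by ring⟩
    have h1 : ∀ a ∈ Multiset.replicate p i, ∃ j, a = m * p ^ j := fun a ha => by
      rwa [Multiset.eq_of_mem_replicate ha]
    rw [Multiset.filter_eq_self.2 h1, Multiset.filter_singleton, if_pos h']
    simp [mul_comm]
  · rw [Multiset.filter_eq_nil.2]
    · simp
    · intro a ha
      rw [Multiset.eq_of_mem_replicate ha]
      exact h

lemma MergeStep.powSum_le {k p : ℕ} {a b : Fin k → Multiset ℕ} (h : MergeStep p a b)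
    (m : ℕ) (i : Fin k) : powSum p m (a i) ≤ powSum p m (b i) := by
  obtain ⟨j, l, -, hle, hj, hne⟩ := h
  by_cases hi : i = j
  · subst hi
    rw [hj, powSum_add]
    conv_lhs => rw [← tsub_add_cancel_of_le hle, powSum_add]
    exact Nat.add_le_add_left (powSum_merge_le m l) _
  · rw [hne i hi]

lemma powSum_le_of_reflTransGen {k p : ℕ} {a b : Fin k → Multiset ℕ}
    (h : Relation.ReflTransGen (MergeStep p) a b) (m : ℕ) (i : Fin k) :
    powSum p m (a i) ≤ powSum p m (b i) := by
  induction h with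
  | refl => exact le_rfl
  | tail _ h ih => exact ih.trans (h.powSum_le m i)

/-- If no part occurs `p` times and all parts are below `m * p ^ J`, the parts `m * p ^ j`
have total size below `m * p ^ J`. -/
lemma powSum_lt_of_count_lt {p m J : ℕ} (hp : 2 ≤ p) (hm : 0 < m) {s : Multiset ℕ}
    (hs : ∀ i, s.count i < p) (hJ : ∀ i ∈ s, i < m * p ^ J) :
    powSum p m s < m * p ^ J := by
  classical
  have hsum : powSum p m s ≤ ∑ j ∈ Finset.range J, (p - 1) * (m * p ^ j) := by
    unfold powSum
    rw [Finset.sum_multiset_count]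
    calc _ ≤ ∑ i ∈ (Finset.range J).image (fun j => m * p ^ j), (p - 1) * i := by
            refine (Finset.sum_le_sum fun i _ => ?_).trans
              (Finset.sum_le_sum_of_subset ?_)
            · rw [smul_eq_mul]
              refine Nat.mul_le_mul_right _ ?_
              have := Multiset.count_le_of_le i (Multiset.filter_le
                (fun i => ∃ j, i = m * p ^ j) s)
              have := hs i
              omega
            · intro i hi
              rw [Multiset.mem_toFinset, Multiset.mem_filter] at hi
              obtain ⟨his, j, rfl⟩ := hi
              have h1 := hJ _ his
              rw [Finset.mem_image]
              refine ⟨j, Finset.mem_range.2 ?_, rfl⟩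
              exact (Nat.pow_lt_pow_iff_right (by omega)).1 (Nat.lt_of_mul_lt_mul_left h1)
      _ ≤ _ := by
            rw [Finset.sum_image]
            intro a _ b _ hab
            exact Nat.pow_right_injective hp (Nat.eq_of_mul_eq_mul_left hm hab)
  refine hsum.trans_lt ?_
  have h2 : ∀ J, ∑ j ∈ Finset.range J, (p - 1) * (m * p ^ j) + m = m * p ^ J := by
    intro J
    induction J with
    | zero => simp
    | succ J ih =>
      rw [Finset.sum_range_succ, add_right_comm, ih]
      obtain ⟨q, rfl⟩ : ∃ q, p = q + 1 := ⟨p - 1, by omega⟩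
      simp only [Nat.add_sub_cancel]
      ring
  have := h2 J
  omega

/-- Every finite subfamily of `S`, with each multiset weighted by `x` to the power of its sum,
has total weight at most `C`. -/
def WeightLE (x : ℝ) (S : Set (Multiset ℕ)) (C : ℝ) : Prop :=
  ∀ F : Finset (Multiset ℕ), ↑F ⊆ S → ∑ s ∈ F, x ^ s.sum ≤ C

namespace WeightLE

variable {x : ℝ} {S A B : Set (Multiset ℕ)} {a b C : ℝ}

lemma mono (h : WeightLE x S C) (hA : A ⊆ S) : WeightLE x A C :=
  fun F hF => h F (hF.trans hA)

lemma nonneg (h : WeightLE x S C) : 0 ≤ C := by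
  simpa using h ∅ (by simp)

lemma trans_le (h : WeightLE x S a) (hab : a ≤ b) : WeightLE x S b :=
  fun F hF => (h F hF).trans hab

lemma empty : WeightLE x ∅ 0 := by
  intro F hF
  have : F = ∅ := by simpa using hF
  simp [this]

lemma of_subset_singleton {s : Multiset ℕ} (hx : 0 ≤ x) (hS : S ⊆ {s}) :
    WeightLE x S (x ^ s.sum) := by
  intro F hF
  have : F ⊆ {s} := by
    intro t ht
    simpa using hS (hF ht)
  refine (Finset.sum_le_sum_of_subset_of_nonneg this fun t _ _ => pow_nonneg hx _).trans ?_
  simp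

lemma of_add (hx : 0 ≤ x) (hA : WeightLE x A a) (hB : WeightLE x B b)
    (h : ∀ s ∈ S, ∃ u ∈ A, ∃ v ∈ B, s = u + v) : WeightLE x S (a * b) := by
  classical
  intro F hF
  have h' : ∀ s : Multiset ℕ, ∃ u v, s ∈ F → u ∈ A ∧ v ∈ B ∧ s = u + v := by
    intro s
    by_cases hs : s ∈ F
    · obtain ⟨u, hu, v, hv, e⟩ := h s (hF hs)
      exact ⟨u, v, fun _ => ⟨hu, hv, e⟩⟩
    · exact ⟨0, 0, fun h => absurd h hs⟩
  choose u v huv using h'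
  calc ∑ s ∈ F, x ^ s.sum = ∑ s ∈ F, x ^ (u s).sum * x ^ (v s).sum := by
        refine Finset.sum_congr rfl fun s hs => ?_
        rw [← pow_add, ← Multiset.sum_add, ← (huv s hs).2.2]
    _ = ∑ q ∈ F.image fun s => (u s, v s), x ^ q.1.sum * x ^ q.2.sum := by
        rw [Finset.sum_image]
        intro s hs t ht hst
        rw [(huv s hs).2.2, (huv t ht).2.2]
        simp only [Prod.mk.injEq] at hst
        rw [hst.1, hst.2]
    _ ≤ ∑ q ∈ F.image u ×ˢ F.image v, x ^ q.1.sum * x ^ q.2.sum := by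
        refine Finset.sum_le_sum_of_subset_of_nonneg ?_ fun q _ _ => by positivity
        intro q hq
        obtain ⟨s, hs, rfl⟩ := Finset.mem_image.1 hq
        exact Finset.mem_product.2
          ⟨Finset.mem_image_of_mem _ hs, Finset.mem_image_of_mem _ hs⟩
    _ = (∑ s ∈ F.image u, x ^ s.sum) * ∑ s ∈ F.image v, x ^ s.sum := by
        rw [Finset.sum_product, Finset.sum_mul_sum]
    _ ≤ a * b := by
        refine mul_le_mul (hA _ ?_) (hB _ ?_) (Finset.sum_nonneg fun s _ => by positivity)
          hA.nonneg
        · intro t ht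
          obtain ⟨s, hs, rfl⟩ := Finset.mem_image.1 (Finset.mem_coe.1 ht)
          exact (huv s hs).1
        · intro t ht
          obtain ⟨s, hs, rfl⟩ := Finset.mem_image.1 (Finset.mem_coe.1 ht)
          exact (huv s hs).2.1

lemma of_biUnion {ι : Type*} (t : Finset ι) {A : ι → Set (Multiset ℕ)} {a : ι → ℝ}
    (hx : 0 ≤ x) (hA : ∀ i ∈ t, WeightLE x (A i) (a i)) (h : ∀ s ∈ S, ∃ i ∈ t, s ∈ A i) :
    WeightLE x S (∑ i ∈ t, a i) := by
  classical
  intro F hF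
  calc ∑ s ∈ F, x ^ s.sum ≤ ∑ s ∈ F, ∑ i ∈ t, if s ∈ A i then x ^ s.sum else 0 := by
        refine Finset.sum_le_sum fun s hs => ?_
        obtain ⟨i, hi, hsi⟩ := h s (hF hs)
        refine le_trans ?_ (Finset.single_le_sum (fun j _ => ?_) hi)
        · rw [if_pos hsi]
        · split_ifs <;> positivity
    _ = ∑ i ∈ t, ∑ s ∈ F.filter (· ∈ A i), x ^ s.sum := by
        rw [Finset.sum_comm]
        simp_rw [Finset.sum_filter]
    _ ≤ ∑ i ∈ t, a i := by
        refine Finset.sum_le_sum fun i hi => hA i hi _ ?_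
        intro s hs
        exact (Finset.mem_filter.1 (Finset.mem_coe.1 hs)).2

/-- The multisets with all parts equal to `i`. -/
lemma of_eq_replicate (hx : 0 ≤ x) (hx1 : x < 1) {i : ℕ} (hi : 0 < i) :
    WeightLE x {s | ∀ j ∈ s, j = i} (1 - x ^ i)⁻¹ := by
  classical
  intro F hF
  have hxi : x ^ i < 1 := pow_lt_one₀ hx hx1 hi.ne'
  have key : ∀ s ∈ F, s = Multiset.replicate s.card i := fun s hs =>
    Multiset.eq_replicate_card.2 (hF hs)
  calc ∑ s ∈ F, x ^ s.sum = ∑ s ∈ F, (x ^ i) ^ s.card := by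
        refine Finset.sum_congr rfl fun s hs => ?_
        conv_lhs => rw [key s hs]
        simp [← pow_mul, mul_comm]
    _ = ∑ c ∈ F.image Multiset.card, (x ^ i) ^ c := by
        rw [Finset.sum_image]
        intro s hs t ht hst
        rw [key s hs, key t ht]
        rw [show s.card = t.card from hst]
    _ ≤ ∑' c : ℕ, (x ^ i) ^ c :=
        (summable_geometric_of_lt_one (by positivity) hxi).sum_le_tsum _ fun c _ => by positivity
    _ = _ := tsum_geometric_of_lt_one (by positivity) hxi

/-- The multisets with all parts in `V`. -/
lemma of_parts_mem (hx : 0 ≤ x) (hx1 : x < 1) (V : Finset ℕ) (hV : ∀ i ∈ V, 0 < i) :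
    WeightLE x {s | ∀ j ∈ s, j ∈ V} (∏ i ∈ V, (1 - x ^ i)⁻¹) := by
  classical
  induction V using Finset.induction_on with
  | empty =>
    have := of_subset_singleton (x := x) (S := {s | ∀ j ∈ s, j ∈ (∅ : Finset ℕ)}) (s := 0) hx
      (by
        intro s hs
        simpa [Multiset.eq_zero_iff_forall_notMem] using hs)
    simpa using this
  | insert i V hi ih =>
    rw [Finset.prod_insert hi]
    refine of_add hx (of_eq_replicate hx hx1 (hV i (by simp)))
      (ih fun j hj => hV j (by simp [hj])) fun s hs => ?_
    refine ⟨s.filter (· = i), ?_, s.filter (¬ · = i), ?_, (Multiset.filter_add_not _ s).symm⟩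
    · intro j hj
      exact (Multiset.mem_filter.1 hj).2
    · intro j hj
      obtain ⟨h1, h2⟩ := Multiset.mem_filter.1 hj
      exact Finset.mem_of_mem_insert_of_ne (hs j h1) h2

/-- Multisets whose restrictions to the parts in `P i` lie in `A i`, and whose other parts
lie in `V`. -/
lemma of_blocks {ι : Type*} (I : Finset ι) (P : ι → ℕ → Prop) [∀ i, DecidablePred (P i)]
    {A : ι → Set (Multiset ℕ)} {w : ι → ℝ} (V : Finset ℕ) (hV : ∀ i ∈ V, 0 < i)
    (hx : 0 ≤ x) (hx1 : x < 1) (hA : ∀ i ∈ I, WeightLE x (A i) (w i))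
    (hdisj : ∀ i ∈ I, ∀ j ∈ I, i ≠ j → ∀ n, P i n → ¬ P j n) :
    WeightLE x {s | (∀ i ∈ I, s.filter (P i) ∈ A i) ∧ ∀ n ∈ s, n ∈ V ∨ ∃ i ∈ I, P i n}
      ((∏ i ∈ I, w i) * ∏ n ∈ V, (1 - x ^ n)⁻¹) := by
  classical
  induction I using Finset.induction_on with
  | empty => simpa using of_parts_mem hx hx1 V hV
  | insert i I hi ih =>
    rw [Finset.prod_insert hi, mul_assoc]
    refine of_add hx (hA i (by simp)) (ih (fun j hj => hA j (by simp [hj]))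
      fun a ha b hb => hdisj a (by simp [ha]) b (by simp [hb])) fun s hs => ?_
    refine ⟨s.filter (P i), hs.1 i (by simp), s.filter (¬ P i ·), ⟨fun j hj => ?_, fun n hn => ?_⟩,
      (Multiset.filter_add_not _ s).symm⟩
    · have hij : j ≠ i := by
        rintro rfl
        exact hi hj
      have : (s.filter (¬ P i ·)).filter (P j) = s.filter (P j) := by
        rw [Multiset.filter_filter]
        refine Multiset.filter_congr fun n _ => ?_
        have := hdisj j (by simp [hj]) i (by simp) hij n
        tauto
      rw [this]
      exact hs.1 j (by simp [hj])
    · obtain ⟨h1, h2⟩ := Multiset.mem_filter.1 hn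
      rcases hs.2 n h1 with h | ⟨j, hj, hPj⟩
      · exact Or.inl h
      · rcases Finset.mem_insert.1 hj with rfl | hj
        · exact absurd hPj h2
        · exact Or.inr ⟨j, hj, hPj⟩

end WeightLE

lemma pow_succ_le_pow_succ_add {a b w : ℕ} (hba : b ≤ a) (hab : a ≤ b + w) (r : ℕ) :
    a ^ (r + 1) ≤ b ^ (r + 1) + (r + 1) * w * a ^ r := by
  induction r with
  | zero => simpa using hab
  | succ r ih =>
    calc a ^ (r + 1 + 1) = a * a ^ (r + 1) := by ring
      _ ≤ a * (b ^ (r + 1) + (r + 1) * w * a ^ r) := Nat.mul_le_mul_left _ ih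
      _ = a * b ^ (r + 1) + (r + 1) * w * a ^ (r + 1) := by ring
      _ ≤ (b + w) * b ^ (r + 1) + (r + 1) * w * a ^ (r + 1) := by gcongr
      _ = b ^ (r + 1 + 1) + w * b ^ (r + 1) + (r + 1) * w * a ^ (r + 1) := by ring
      _ ≤ b ^ (r + 1 + 1) + w * a ^ (r + 1) + (r + 1) * w * a ^ (r + 1) := by gcongr
      _ = b ^ (r + 1 + 1) + (r + 1 + 1) * w * a ^ (r + 1) := by ring

lemma pow_succ_le_sum_sub_mul_pow {w : ℕ} (hw : 0 < w) (y r : ℕ) :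
    y ^ (r + 1) ≤ (r + 1) * w *
      ∑ c ∈ (Finset.range y).filter (fun c => c * w < y), (y - c * w) ^ r := by
  have tel : ∀ n, y ^ (r + 1) ≤ (y - n * w) ^ (r + 1) + (r + 1) * w *
      ∑ c ∈ (Finset.range n).filter (fun c => c * w < y), (y - c * w) ^ r := by
    intro n
    induction n with
    | zero => simp
    | succ n ih =>
      refine ih.trans ?_
      rw [Finset.range_add_one, Finset.filter_insert]
      have e : (n + 1) * w = n * w + w := by ring
      split_ifs with h
      · rw [Finset.sum_insert (by simp), mul_add, ← add_assoc]
        gcongr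
        exact pow_succ_le_pow_succ_add (by omega) (by omega) r
      · have h1 : y - n * w = 0 := by omega
        have h2 : y - (n + 1) * w = 0 := by omega
        rw [h1, h2]
  have h0 : y - y * w = 0 := Nat.sub_eq_zero_of_le (Nat.le_mul_of_pos_right y hw)
  simpa [h0] using tel y

/-- Multisets of parts `m * p ^ j` with `j ≤ r`, of total size less than `m * y`. -/
def powBlock (p m r y : ℕ) : Set (Multiset ℕ) :=
  {s | (∀ i ∈ s, ∃ j ≤ r, i = m * p ^ j) ∧ s.sum < m * y}

lemma weightLE_powBlock {x : ℝ} (hx : 0 ≤ x) (hx1 : x < 1) {p m : ℕ} (hp : 0 < p) (hm : 0 < m)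
    (r y : ℕ) :
    WeightLE x (powBlock p m r y) (∏ j ∈ Finset.range (r + 1), (1 - (x ^ m) ^ p ^ j)⁻¹ -
      (x ^ m) ^ y * y ^ r / (r.factorial * (∏ j ∈ Finset.range r, (p : ℝ) ^ (j + 1)) *
        (1 - x ^ m))) := by
  set q := x ^ m with hq
  have hq0 : 0 ≤ q := pow_nonneg hx m
  have hq1 : q < 1 := pow_lt_one₀ hx hx1 hm.ne'
  induction r generalizing y with
  | zero =>
    have h := WeightLE.of_biUnion (x := x) (S := powBlock p m 0 y) (Finset.range y)
      (A := fun c => {Multiset.replicate c m}) (a := fun c => q ^ c) hx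
      (fun c _ => by
        have := WeightLE.of_subset_singleton (S := {Multiset.replicate c m}) hx subset_rfl
        rwa [Multiset.sum_replicate, smul_eq_mul, mul_comm c m, pow_mul] at this)
      (by
        rintro s ⟨hs, hsum⟩
        have e : s = Multiset.replicate s.card m :=
          Multiset.eq_replicate_card.2 fun i hi => by
            obtain ⟨j, hj, rfl⟩ := hs i hi
            simp [Nat.le_zero.1 hj]
        refine ⟨s.card, Finset.mem_range.2 ?_, e⟩
        rw [e, Multiset.sum_replicate, smul_eq_mul, mul_comm] at hsum
        exact Nat.lt_of_mul_lt_mul_left hsum)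
    refine h.trans_le (le_of_eq ?_)
    rw [geom_sum_eq hq1.ne]
    have : q - 1 ≠ 0 := by linarith
    have : 1 - q ≠ 0 := by linarith
    simp
    field_simp
    ring
  | succ r ih =>
    set w := p ^ (r + 1) with hw
    have hw0 : 0 < w := pow_pos hp _
    set Z := ∏ j ∈ Finset.range (r + 1), (1 - q ^ p ^ j)⁻¹ with hZ
    set D : ℝ := r.factorial * (∏ j ∈ Finset.range r, (p : ℝ) ^ (j + 1)) * (1 - q) with hD
    have hD0 : 0 < D := by
      have : 0 < 1 - q := by linarith
      positivity
    set t := (Finset.range y).filter (fun c => c * w < y) with ht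
    have hZ0 : 0 ≤ Z := Finset.prod_nonneg fun j _ => by
      have : q ^ p ^ j ≤ 1 := pow_le_one₀ hq0 hq1.le
      exact inv_nonneg.2 (by linarith)
    have h := WeightLE.of_biUnion (x := x) (S := powBlock p m (r + 1) y) t
      (A := fun c => {s | ∃ v ∈ powBlock p m r (y - c * w),
        s = Multiset.replicate c (m * w) + v})
      (a := fun c => q ^ (c * w) * (Z - q ^ (y - c * w) * ((y - c * w : ℕ) : ℝ) ^ r / D)) hx
      (fun c _ => by
        have h1 := WeightLE.of_subset_singleton (S := {Multiset.replicate c (m * w)}) hx subset_rfl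
        rw [Multiset.sum_replicate, smul_eq_mul, mul_left_comm, pow_mul, ← hq] at h1
        refine WeightLE.of_add hx h1 (ih (y - c * w)) ?_
        rintro s ⟨v, hv, rfl⟩
        exact ⟨_, rfl, v, hv, rfl⟩)
      (by
        rintro s ⟨hs, hsum⟩
        have e : s = Multiset.replicate (s.count (m * w)) (m * w) +
            s.filter (¬ · = m * w) := by
          rw [← Multiset.filter_eq', Multiset.filter_add_not]
        have es := congrArg Multiset.sum e
        rw [Multiset.sum_add, Multiset.sum_replicate, smul_eq_mul] at es
        set c := s.count (m * w) with hc
        have hcw : m * (c * w) = c * (m * w) := by ring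
        have hlt : c * w < y := by
          refine Nat.lt_of_mul_lt_mul_left (a := m) ?_
          omega
        refine ⟨c, Finset.mem_filter.2 ⟨Finset.mem_range.2 ?_, hlt⟩, _, ⟨?_, ?_⟩, e⟩
        · exact lt_of_le_of_lt (Nat.le_mul_of_pos_right c hw0) hlt
        · intro i hi
          obtain ⟨h1, h2⟩ := Multiset.mem_filter.1 hi
          obtain ⟨j, hj, rfl⟩ := hs i h1
          refine ⟨j, ?_, rfl⟩
          rcases hj.lt_or_eq with hj | rfl
          · omega
          · exact absurd rfl h2
        · rw [Nat.mul_sub]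
          omega)
    refine h.trans_le ?_
    have e1 : ∑ c ∈ t, q ^ (c * w) * (Z - q ^ (y - c * w) * ((y - c * w : ℕ) : ℝ) ^ r / D) =
        Z * ∑ c ∈ t, (q ^ w) ^ c - q ^ y / D * ∑ c ∈ t, ((y - c * w : ℕ) : ℝ) ^ r := by
      rw [Finset.mul_sum, Finset.mul_sum, ← Finset.sum_sub_distrib]
      refine Finset.sum_congr rfl fun c hc => ?_
      have hlt := (Finset.mem_filter.1 hc).2
      have : q ^ y = q ^ (c * w) * q ^ (y - c * w) := by
        rw [← pow_add]
        congr 1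
        omega
      rw [this, ← pow_mul q w c, mul_comm w c]
      ring
    have hqw : q ^ w < 1 := pow_lt_one₀ hq0 hq1 hw0.ne'
    have e2 : ∑ c ∈ t, (q ^ w) ^ c ≤ (1 - q ^ w)⁻¹ := by
      rw [← tsum_geometric_of_lt_one (by positivity) hqw]
      exact (summable_geometric_of_lt_one (by positivity) hqw).sum_le_tsum _
        fun c _ => by positivity
    have e3 : (y : ℝ) ^ (r + 1) / ((r + 1) * w) ≤ ∑ c ∈ t, ((y - c * w : ℕ) : ℝ) ^ r := by
      have hw' : (0 : ℝ) < w := by exact_mod_cast hw0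
      rw [div_le_iff₀ (by positivity), mul_comm]
      exact_mod_cast pow_succ_le_sum_sub_mul_pow hw0 y r
    rw [e1, Finset.prod_range_succ, ← hZ, ← hw]
    have e4 : q ^ y * (y : ℝ) ^ (r + 1) / ((r + 1).factorial *
        (∏ j ∈ Finset.range (r + 1), (p : ℝ) ^ (j + 1)) * (1 - q)) =
        q ^ y / D * ((y : ℝ) ^ (r + 1) / ((r + 1) * w)) := by
      rw [Finset.prod_range_succ, Nat.factorial_succ, hD, hw]
      push_cast
      rw [div_mul_div_comm]
      congr 1
      ring
    rw [e4]
    have := mul_le_mul_of_nonneg_left e2 hZ0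
    have := mul_le_mul_of_nonneg_left e3 (show 0 ≤ q ^ y / D by positivity)
    linarith

lemma hasSum_inv_succ_sq : HasSum (fun n : ℕ => 1 / ((n : ℝ) + 1) ^ 2) (π ^ 2 / 6) := by
  have := (hasSum_nat_add_iff' 1).2 hasSum_zeta_two
  simpa using this

lemma one_sub_exp_neg_inv_le {y : ℝ} (hy : 0 < y) : (1 - exp (-y))⁻¹ ≤ 1 + 1 / y := by
  have h1 : exp (-y) ≤ (1 + y)⁻¹ := by
    rw [exp_neg]
    exact inv_anti₀ (by linarith) (by linarith [add_one_le_exp y])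
  have h2 : y / (1 + y) ≤ 1 - exp (-y) := by
    have : y / (1 + y) = 1 - (1 + y)⁻¹ := by field_simp; ring
    linarith
  calc (1 - exp (-y))⁻¹ ≤ (y / (1 + y))⁻¹ := inv_anti₀ (by positivity) h2
    _ = 1 + 1 / y := by field_simp; ring

lemma prod_one_sub_inv_le {t : ℝ} (ht : 0 < t) (U : Finset ℕ) (hU : ∀ i ∈ U, 0 < i) :
    ∏ i ∈ U, (1 - exp (-t) ^ i)⁻¹ ≤ exp (π ^ 2 / (6 * t)) := by
  have hlt : ∀ i ∈ U, exp (-t) ^ i < 1 := fun i hi =>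
    pow_lt_one₀ (exp_pos _).le (exp_lt_one_iff.2 (by linarith)) (hU i hi).ne'
  have e : ∏ i ∈ U, (1 - exp (-t) ^ i)⁻¹ = exp (∑ i ∈ U, -log (1 - exp (-t) ^ i)) := by
    rw [exp_sum]
    refine Finset.prod_congr rfl fun i hi => ?_
    have := hlt i hi
    rw [exp_neg (log _), exp_log (by linarith)]
  rw [e]
  refine exp_le_exp.2 ?_
  have h1 : HasSum (fun n : ℕ => ∑ i ∈ U, (exp (-t) ^ i) ^ (n + 1) / ((n : ℝ) + 1))
      (∑ i ∈ U, -log (1 - exp (-t) ^ i)) :=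
    hasSum_sum fun i hi => hasSum_pow_div_log_of_abs_lt_one
      (by rw [abs_of_nonneg (by positivity)]; exact hlt i hi)
  have h2 := hasSum_inv_succ_sq.div_const t
  rw [show π ^ 2 / (6 * t) = π ^ 2 / 6 / t by field_simp]
  refine hasSum_le (fun n => ?_) h1 h2
  set y := t * ((n : ℝ) + 1) with hy
  have hy0 : 0 < y := by positivity
  have hw : exp (-y) < 1 := exp_lt_one_iff.2 (by linarith)
  rw [← Finset.sum_div]
  have h3 : ∑ i ∈ U, (exp (-t) ^ i) ^ (n + 1) ≤ 1 / y := by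
    have e1 : ∀ i, (exp (-t) ^ i) ^ (n + 1) = exp (-y) ^ i := by
      intro i
      rw [← pow_mul, mul_comm, pow_mul, ← exp_nat_mul]
      congr 2
      push_cast
      rw [hy]
      ring
    simp_rw [e1]
    have h0 : 0 ∉ U := fun h => (hU 0 h).ne' rfl
    have h4 := (summable_geometric_of_lt_one (exp_pos (-y)).le hw).sum_le_tsum (insert 0 U)
      fun c _ => by positivity
    rw [tsum_geometric_of_lt_one (exp_pos (-y)).le hw, Finset.sum_insert h0, pow_zero] at h4
    linarith [one_sub_exp_neg_inv_le hy0]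
  calc _ ≤ 1 / y / ((n : ℝ) + 1) := by gcongr
    _ = _ := by rw [hy]; field_simp

lemma mul_exp_neg_le_one_sub_exp_neg (y : ℝ) : y * exp (-y) ≤ 1 - exp (-y) := by
  have h := mul_le_mul_of_nonneg_right (add_one_le_exp y) (exp_pos (-y)).le
  rw [← exp_add] at h
  simp at h
  linarith

lemma sum_pow_succ_le {p : ℕ} (hp : 2 ≤ p) (r : ℕ) :
    ∑ j ∈ Finset.range r, p ^ (j + 1) ≤ p ^ (r + 1) := by
  induction r with
  | zero => simp
  | succ r ih =>
    rw [Finset.sum_range_succ, pow_succ p (r + 1)]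
    nlinarith [Nat.mul_le_mul_left (p ^ (r + 1)) hp]

/-- The weight of a block falls short of the full block by a factor. -/
lemma weightLE_powBlock_exp {t : ℝ} (ht : 0 < t) {p m : ℕ} (hp : 2 ≤ p) (hm : 0 < m)
    (r y : ℕ) :
    WeightLE (exp (-t)) (powBlock p m r y)
      ((∏ j ∈ Finset.range (r + 1), (1 - (exp (-t)) ^ (m * p ^ j))⁻¹) *
        exp (-(exp (-(t * m * (y + p ^ (r + 1)))) * (t * m * y) ^ r / r.factorial))) := by
  have hx1 : exp (-t) < 1 := exp_lt_one_iff.2 (by linarith)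
  refine (weightLE_powBlock (exp_pos _).le hx1 (by omega) hm r y).trans_le ?_
  simp_rw [pow_mul]
  set q := exp (-t) ^ m with hq
  have hq0 : 0 < q := pow_pos (exp_pos _) m
  have hq1 : q < 1 := pow_lt_one₀ (exp_pos _).le hx1 hm.ne'
  set θ := t * m with hθ
  have hθ0 : 0 < θ := by positivity
  have hqθ : ∀ i : ℕ, q ^ i = exp (-(θ * i)) := by
    intro i
    rw [hq, ← pow_mul, ← exp_nat_mul]
    congr 1
    push_cast
    ring
  have hqj : ∀ j, 0 < 1 - q ^ p ^ j := fun j => by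
    have := pow_lt_one₀ hq0.le hq1 (pow_pos (by omega : 0 < p) j).ne'
    linarith
  set Z := ∏ j ∈ Finset.range (r + 1), (1 - q ^ p ^ j)⁻¹ with hZ
  have hZ0 : 0 < Z := Finset.prod_pos fun j _ => inv_pos.2 (hqj j)
  set E := exp (-(θ * (y + p ^ (r + 1)))) * (θ * y) ^ r / r.factorial with hE
  have hprod : θ ^ r * (∏ j ∈ Finset.range r, (p : ℝ) ^ (j + 1)) * exp (-(θ * p ^ (r + 1))) ≤
      ∏ j ∈ Finset.range r, (1 - q ^ p ^ (j + 1)) := by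
    have hle : ∑ j ∈ Finset.range r, (p : ℝ) ^ (j + 1) ≤ (p : ℝ) ^ (r + 1) := by
      exact_mod_cast sum_pow_succ_le hp r
    calc _ ≤ θ ^ r * (∏ j ∈ Finset.range r, (p : ℝ) ^ (j + 1)) *
          exp (-(θ * ∑ j ∈ Finset.range r, (p : ℝ) ^ (j + 1))) := by gcongr
      _ = ∏ j ∈ Finset.range r, (θ * (p : ℝ) ^ (j + 1)) * exp (-(θ * (p : ℝ) ^ (j + 1))) := by
          rw [Finset.prod_mul_distrib, Finset.prod_mul_distrib, ← exp_sum,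
            Finset.sum_neg_distrib, Finset.mul_sum]
          simp
      _ ≤ _ := by
          refine Finset.prod_le_prod (fun j _ => by positivity) fun j _ => ?_
          rw [hqθ]
          push_cast
          exact mul_exp_neg_le_one_sub_exp_neg _
  have hZ' : (1 - q)⁻¹ = Z * ∏ j ∈ Finset.range r, (1 - q ^ p ^ (j + 1)) := by
    rw [hZ, Finset.prod_range_succ', mul_right_comm, ← Finset.prod_mul_distrib,
      Finset.prod_eq_one, one_mul, pow_zero, pow_one]
    intro j _
    exact inv_mul_cancel₀ (hqj _).ne'
  set W := ∏ j ∈ Finset.range r, (p : ℝ) ^ (j + 1) with hW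
  have hW0 : 0 < W := Finset.prod_pos fun j _ => pow_pos (by exact_mod_cast (by omega : 0 < p)) _
  have main : Z * E ≤ q ^ y * y ^ r / (r.factorial * W * (1 - q)) := by
    have e1 : q ^ y * y ^ r / (r.factorial * W * (1 - q)) =
        q ^ y * y ^ r / (r.factorial * W) * (Z * ∏ j ∈ Finset.range r, (1 - q ^ p ^ (j + 1))) := by
      rw [← hZ']
      field_simp
    have e2 : Z * E = q ^ y * y ^ r / (r.factorial * W) *
        (Z * (θ ^ r * W * exp (-(θ * p ^ (r + 1))))) := by
      rw [hE, hqθ, mul_add, neg_add, exp_add, mul_pow]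
      field_simp
    rw [e1, e2]
    gcongr
  calc _ ≤ Z * (-E + 1) := by linarith
    _ ≤ Z * exp (-E) := by
        gcongr
        exact add_one_le_exp _

/-- Chernoff-type bound for the number of partitions of `n` none of whose chains `m * p ^ j`,
with `m ∈ I`, carries total size at least `m * s`. -/
lemma card_powSum_lt_le {t : ℝ} (ht : 0 < t) {p : ℕ} (hp : 2 ≤ p) (r s n : ℕ) (I : Finset ℕ)
    (hI : ∀ m ∈ I, 0 < m)
    (hdisj : ∀ a ∈ I, ∀ b ∈ I, a ≠ b → ∀ i j, a * p ^ i ≠ b * p ^ j)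
    (F : Finset n.Partition) (hF : ∀ l ∈ F, ∀ m ∈ I, powSum p m l.parts < m * s) :
    (F.card : ℝ) ≤ exp (t * n) * exp (π ^ 2 / (6 * t)) *
      exp (-∑ m ∈ I, exp (-(t * m * (s + p ^ (r + 1)))) * (t * m * s) ^ r / r.factorial) := by
  classical
  set E : ℕ → ℝ := fun m => exp (-(t * m * (s + p ^ (r + 1)))) * (t * m * s) ^ r / r.factorial
  set x := exp (-t) with hx
  have hx1 : x < 1 := exp_lt_one_iff.2 (by linarith)
  set U := I.biUnion fun m => (Finset.range (r + 1)).image fun j => m * p ^ j with hU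
  set V := Finset.Icc 1 n \ U with hV
  have hUpos : ∀ i ∈ U, 0 < i := by
    intro i hi
    obtain ⟨m, hm, hi⟩ := Finset.mem_biUnion.1 hi
    obtain ⟨j, -, rfl⟩ := Finset.mem_image.1 hi
    have := hI m hm
    positivity
  have hVpos : ∀ i ∈ V, 0 < i := fun i hi => (Finset.mem_Icc.1 (Finset.mem_sdiff.1 hi).1).1
  have hW := WeightLE.of_blocks (x := x) I (fun m i => ∃ j ≤ r, i = m * p ^ j)
    (A := fun m => powBlock p m r s) V hVpos (exp_pos _).le hx1
    (fun m hm => weightLE_powBlock_exp ht hp (hI m hm) r s)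
    (by
      rintro a ha b hb hab i ⟨j, -, rfl⟩ ⟨j', -, h⟩
      exact hdisj a ha b hb hab j j' h)
  have hcard := hW (F.image fun l => l.parts) (by
    intro u hu
    obtain ⟨l, hl, rfl⟩ := Finset.mem_image.1 (Finset.mem_coe.1 hu)
    refine ⟨fun m hm => ⟨fun i hi => (Multiset.mem_filter.1 hi).2, ?_⟩, fun i hi => ?_⟩
    · refine lt_of_le_of_lt ?_ (hF l hl m hm)
      unfold powSum
      obtain ⟨u, hu⟩ := Multiset.le_iff_exists_add.1 (Multiset.monotone_filter_right l.parts
        (p := fun i => ∃ j ≤ r, i = m * p ^ j) (q := fun i => ∃ j, i = m * p ^ j)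
        fun i ⟨j, _, h⟩ => ⟨j, h⟩)
      rw [hu, Multiset.sum_add]
      exact Nat.le_add_right _ _
    · by_cases h : i ∈ U
      · obtain ⟨m, hm, hi⟩ := Finset.mem_biUnion.1 h
        obtain ⟨j, hj, rfl⟩ := Finset.mem_image.1 hi
        exact Or.inr ⟨m, hm, j, by have := Finset.mem_range.1 hj; omega, rfl⟩
      · exact Or.inl (Finset.mem_sdiff.2
          ⟨Finset.mem_Icc.2 ⟨l.parts_pos hi, l.le_of_mem_parts hi⟩, h⟩))
  have hinj : Function.Injective fun l : n.Partition => l.parts := fun a b h => Nat.Partition.ext h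
  rw [Finset.sum_image hinj.injOn, Finset.sum_congr rfl fun l _ => by rw [l.parts_sum],
    Finset.sum_const, nsmul_eq_mul] at hcard
  have hZ : (∏ m ∈ I, ∏ j ∈ Finset.range (r + 1), (1 - x ^ (m * p ^ j))⁻¹) =
      ∏ i ∈ U, (1 - x ^ i)⁻¹ := by
    rw [hU, Finset.prod_biUnion]
    · refine Finset.prod_congr rfl fun m hm => ?_
      rw [Finset.prod_image]
      intro a _ b _ hab
      exact Nat.pow_right_injective hp (Nat.eq_of_mul_eq_mul_left (hI m hm) hab)
    · intro a ha b hb hab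
      refine Finset.disjoint_left.2 fun i hi hi' => ?_
      obtain ⟨j, -, rfl⟩ := Finset.mem_image.1 hi
      obtain ⟨j', -, h⟩ := Finset.mem_image.1 hi'
      exact hdisj a ha b hb hab j j' h.symm
  rw [Finset.prod_mul_distrib, hZ, ← exp_sum, Finset.sum_neg_distrib, mul_right_comm,
    ← Finset.prod_union Finset.disjoint_sdiff] at hcard
  have hprod := prod_one_sub_inv_le ht (U ∪ V) (fun i hi => by
    rcases Finset.mem_union.1 hi with h | h
    · exact hUpos i h
    · exact hVpos i h)
  have hxn : exp (t * n) * x ^ n = 1 := by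
    rw [hx, ← exp_nat_mul, ← exp_add]
    simp [mul_comm]
  calc (F.card : ℝ) = exp (t * n) * (F.card * x ^ n) := by
        rw [mul_left_comm, hxn, mul_one]
    _ ≤ exp (t * n) * (exp (π ^ 2 / (6 * t)) * exp (-∑ m ∈ I, E m)) := by
        refine mul_le_mul_of_nonneg_left (hcard.trans ?_) (exp_pos _).le
        exact mul_le_mul_of_nonneg_right hprod (exp_pos _).le
    _ = _ := by ring

lemma card_partition_sub_le {n k v : ℕ} (hv : 0 < v) (hkv : k * v ≤ n) :
    Fintype.card (n - k * v).Partition ≤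
      (Finset.univ.filter fun l : n.Partition => k ≤ l.parts.count v).card := by
  let f : (n - k * v).Partition → n.Partition := fun l =>
    { parts := l.parts + Multiset.replicate k v
      parts_pos := by
        intro i hi
        rcases Multiset.mem_add.1 hi with h | h
        · exact l.parts_pos h
        · rwa [Multiset.eq_of_mem_replicate h]
      parts_sum := by
        rw [Multiset.sum_add, l.parts_sum, Multiset.sum_replicate, smul_eq_mul]
        omega }
  have hf : Function.Injective f := by
    intro a b h
    have := congrArg Nat.Partition.parts h
    exact Nat.Partition.ext (add_right_cancel this)
  rw [← Finset.card_univ, ← Finset.card_image_of_injective _ hf]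
  refine Finset.card_le_card fun l hl => ?_
  obtain ⟨l, -, rfl⟩ := Finset.mem_image.1 hl
  refine Finset.mem_filter.2 ⟨Finset.mem_univ _, ?_⟩
  change k ≤ (l.parts + Multiset.replicate k v).count v
  rw [Multiset.count_add, Multiset.count_replicate_self]
  exact Nat.le_add_left _ _

lemma sum_mul_card_partition_le (n : ℕ) :
    ∑ k ∈ Finset.Icc 1 n, ∑ v ∈ Finset.Icc 1 n,
      (if k * v ≤ n then v * Fintype.card (n - k * v).Partition else 0) ≤
      n * Fintype.card n.Partition := by
  have h1 : n * Fintype.card n.Partition =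
      ∑ l : n.Partition, ∑ v ∈ Finset.Icc 1 n, l.parts.count v * v := by
    rw [mul_comm, ← Finset.card_univ, ← smul_eq_mul, ← Finset.sum_const]
    refine Finset.sum_congr rfl fun l _ => ?_
    conv_lhs => rw [← l.parts_sum]
    rw [Finset.sum_multiset_count_of_subset l.parts (Finset.Icc 1 n)]
    · rfl
    · intro i hi
      rw [Multiset.mem_toFinset] at hi
      exact Finset.mem_Icc.2 ⟨l.parts_pos hi, l.le_of_mem_parts hi⟩
  rw [h1, Finset.sum_comm, Finset.sum_comm (s := Finset.univ)]
  refine Finset.sum_le_sum fun v hv => ?_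
  have hv0 : 0 < v := (Finset.mem_Icc.1 hv).1
  calc _ ≤ ∑ k ∈ Finset.Icc 1 n, ∑ l : n.Partition, if k ≤ l.parts.count v then v else 0 := by
        refine Finset.sum_le_sum fun k _ => ?_
        split_ifs with h
        · rw [← Finset.sum_filter, Finset.sum_const, smul_eq_mul, mul_comm v]
          exact Nat.mul_le_mul_right _ (card_partition_sub_le hv0 h)
        · exact Nat.zero_le _
    _ = ∑ l : n.Partition, ∑ k ∈ Finset.Icc 1 n, if k ≤ l.parts.count v then v else 0 :=
        Finset.sum_comm
    _ ≤ _ := by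
        refine Finset.sum_le_sum fun l _ => ?_
        rw [← Finset.sum_filter, Finset.sum_const, smul_eq_mul]
        refine Nat.mul_le_mul_right _ ?_
        calc _ ≤ (Finset.Icc 1 (l.parts.count v)).card := by
              refine Finset.card_le_card fun k hk => ?_
              simp only [Finset.mem_filter, Finset.mem_Icc] at hk ⊢
              exact ⟨hk.1.1, hk.2⟩
          _ = _ := by simp

/-- Tangent-type lower bound for `exp (2 c √m) / m ^ K` at `m = R ^ 2 - u`. -/
lemma exp_sqrt_div_pow_sub_ge {c R u : ℝ} (hc : 0 ≤ c) (hR : 0 < R) (hu : 0 ≤ u) (huR : u < R ^ 2)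
    (K : ℕ) :
    exp (2 * c * R) / (R ^ 2) ^ K *
      (exp (-(c * u / R)) * max (1 + K * u / R ^ 2 - c * u ^ 2 / R ^ 3) 0) ≤
      exp (2 * c * √(R ^ 2 - u)) / (R ^ 2 - u) ^ K := by
  set z := u / R ^ 2 with hz
  have hu' : u = z * R ^ 2 := by rw [hz]; field_simp
  have hz0 : 0 ≤ z := by positivity
  have hz1 : z < 1 := by rw [hz, div_lt_one (by positivity)]; exact huR
  have hsqrt : R * (1 - z / 2 - z ^ 2 / 2) ≤ √(R ^ 2 - u) := by
    refine (le_abs_self _).trans (abs_le_sqrt ?_)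
    have h : (1 - z) * ((1 - z) * (1 + z / 2) ^ 2) ≤ (1 - z) * 1 := by
      refine mul_le_mul_of_nonneg_left ?_ (by linarith)
      nlinarith [pow_nonneg hz0 3, pow_nonneg hz0 2]
    have := mul_le_mul_of_nonneg_left h (sq_nonneg R)
    rw [hu']
    nlinarith
  have hpow : exp (K * z) / (R ^ 2) ^ K ≤ 1 / (R ^ 2 - u) ^ K := by
    have e : R ^ 2 - u = R ^ 2 * (1 - z) := by rw [hu']; ring
    rw [e, mul_pow, div_le_div_iff₀ (by positivity)
      (mul_pos (by positivity) (pow_pos (by linarith) _))]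
    have h1 : exp z * (1 - z) ≤ 1 := by
      have : 1 - z ≤ exp (-z) := one_sub_le_exp_neg z
      calc exp z * (1 - z) ≤ exp z * exp (-z) := by gcongr
        _ = 1 := by rw [← exp_add]; simp
    have h2 : exp (K * z) * (1 - z) ^ K ≤ 1 := by
      rw [exp_nat_mul, ← mul_pow]
      exact pow_le_one₀ (mul_nonneg (exp_pos _).le (by linarith)) h1
    have := mul_le_mul_of_nonneg_left h2 (show 0 ≤ (R ^ 2) ^ K by positivity)
    linarith
  have hmax : max (1 + K * u / R ^ 2 - c * u ^ 2 / R ^ 3) 0 ≤ exp (K * z - c * R * z ^ 2) := by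
    refine max_le ?_ (exp_pos _).le
    have e : 1 + K * u / R ^ 2 - c * u ^ 2 / R ^ 3 = K * z - c * R * z ^ 2 + 1 := by
      rw [hz]
      field_simp
      ring
    rw [e]
    exact add_one_le_exp _
  calc _ ≤ exp (2 * c * R) / (R ^ 2) ^ K *
        (exp (-(c * u / R)) * exp (K * z - c * R * z ^ 2)) := by gcongr
    _ = exp (2 * c * (R * (1 - z / 2 - z ^ 2 / 2))) * (exp (K * z) / (R ^ 2) ^ K) := by
        have e : c * u / R = c * R * z := by rw [hz]; field_simp
        clear_value z
        rw [div_mul_eq_mul_div, ← mul_div_assoc, ← exp_add, ← exp_add, ← exp_add, e]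
        congr 2
        ring
    _ ≤ exp (2 * c * √(R ^ 2 - u)) * (1 / (R ^ 2 - u) ^ K) := by gcongr
    _ = _ := by ring

lemma inv_sq_sub_half_le {y : ℝ} (hy : 0 < y) (hy1 : y ≤ 1) :
    1 / y ^ 2 - 1 / 2 ≤ exp (-y) / (1 - exp (-y)) ^ 2 := by
  have hz : exp (-y) < 1 := exp_lt_one_iff.2 (by linarith)
  have hpos : 0 < (1 - exp (-y)) ^ 2 := pow_pos (by linarith) 2
  have h1 : (1 - exp (-y)) ^ 2 = exp (-y) * (2 * (cosh y - 1)) := by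
    rw [cosh_eq]
    have : exp (-y) * exp y = 1 := by rw [← exp_add]; simp
    linear_combination (-1 : ℝ) * this
  have h2 : cosh y ≤ exp (y ^ 2 / 2) := cosh_le_exp_half_sq y
  have h3 : exp (y ^ 2 / 2) * (1 - y ^ 2 / 2) ≤ 1 := by
    calc _ ≤ exp (y ^ 2 / 2) * exp (-(y ^ 2 / 2)) := by
          gcongr
          exact one_sub_le_exp_neg _
      _ = 1 := by rw [← exp_add]; simp
  have hy2 : y ^ 2 ≤ 1 := pow_le_one₀ hy.le hy1
  have h4 : 2 * (cosh y - 1) * (1 - y ^ 2 / 2) ≤ y ^ 2 := by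
    have := mul_le_mul_of_nonneg_right h2 (show 0 ≤ 1 - y ^ 2 / 2 by linarith)
    linarith
  have e : 1 / y ^ 2 - 1 / 2 = (1 - y ^ 2 / 2) / y ^ 2 := by field_simp
  rw [e, div_le_div_iff₀ (by positivity) hpos, h1]
  have := mul_le_mul_of_nonneg_left h4 (exp_pos (-y)).le
  linarith

lemma pi_sq_div_six_le_sum (Y : ℕ) (hY : Y ≠ 0) :
    π ^ 2 / 6 ≤ ∑ k ∈ Finset.Icc 1 Y, 1 / (k : ℝ) ^ 2 + 1 / Y := by
  rw [← hasSum_zeta_two.tsum_eq]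
  refine Real.tsum_le_of_sum_range_le (fun n => by positivity) fun n => ?_
  have h1 : ∑ i ∈ Finset.range n, 1 / (i : ℝ) ^ 2 ≤
      ∑ i ∈ Finset.range (Y + n + 1), 1 / (i : ℝ) ^ 2 :=
    Finset.sum_le_sum_of_subset_of_nonneg
      (Finset.range_subset_range.2 (by omega)) fun i _ _ => by positivity
  refine h1.trans ?_
  have h2 : Finset.range (Y + n + 1) ⊆ insert 0 (Finset.Icc 1 Y ∪ Finset.Ioc Y (Y + n)) := by
    intro i hi
    simp only [Finset.mem_range, Finset.mem_insert, Finset.mem_union, Finset.mem_Icc,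
      Finset.mem_Ioc] at hi ⊢
    omega
  refine (Finset.sum_le_sum_of_subset_of_nonneg h2 fun i _ _ => by positivity).trans ?_
  rw [Finset.sum_insert (by simp), Finset.sum_union]
  · have h3 := sum_Ioc_inv_sq_le_sub (α := ℝ) hY (Nat.le_add_right Y n)
    simp only [one_div]
    have : (0 : ℝ) ≤ ((Y + n : ℕ) : ℝ)⁻¹ := by positivity
    simp only [Nat.cast_zero, ne_eq, OfNat.ofNat_ne_zero, not_false_eq_true, zero_pow, inv_zero]
    linarith
  · refine Finset.disjoint_left.2 fun i hi hi' => ?_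
    rw [Finset.mem_Icc] at hi
    rw [Finset.mem_Ioc] at hi'
    omega

/-- Lower bound for the contribution of the multiples `k * v` of a fixed `k` in the recursion
for the number of partitions. -/
lemma sum_multiples_ge {c R : ℝ} {n k : ℕ} (hc : 1 ≤ c) (hR : 1501 ≤ R) (hn : (n : ℝ) = R ^ 2)
    (hk : 0 < k) (hkR : c * k ≤ R) :
    R ^ 2 / (c ^ 2 * k ^ 2) - 1 / 2 + 14 * R / (c ^ 3 * k ^ 2) ≤
      ∑ v ∈ Finset.Icc 1 n, if k * v < n then
        (v : ℝ) * (exp (-(c * ((k * v : ℕ) : ℝ) / R)) *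
          max (1 + (1500 : ℕ) * ((k * v : ℕ) : ℝ) / R ^ 2 -
            c * ((k * v : ℕ) : ℝ) ^ 2 / R ^ 3) 0) else 0 := by
  have hR0 : 0 < R := by linarith
  have hk0 : (0 : ℝ) < k := by exact_mod_cast hk
  set y := c * k / R with hy
  have hy0 : 0 < y := by positivity
  have hy1 : y ≤ 1 := by rw [hy, div_le_one hR0]; exact hkR
  set z := exp (-y) with hz
  have hz0 : 0 < z := exp_pos _
  have hz1 : z < 1 := exp_lt_one_iff.2 (by linarith)
  have hz3 : 1 / 3 ≤ z := by
    have h1 : exp (-1) ≤ z := exp_le_exp.2 (by linarith)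
    have h2 : (3 : ℝ)⁻¹ ≤ exp (-1) := by
      rw [exp_neg]
      exact inv_anti₀ (exp_pos _) (by linarith [exp_one_lt_d9])
    norm_num at h2 ⊢
    linarith
  have hzy : 1 - z ≤ y := by linarith [one_sub_le_exp_neg y]
  have hzy' : y / 3 ≤ 1 - z := by
    have := mul_exp_neg_le_one_sub_exp_neg y
    have := mul_le_mul_of_nonneg_left hz3 hy0.le
    linarith
  set α : ℝ := 1500 * k / R ^ 2 with hα
  set β : ℝ := c * k ^ 2 / R ^ 3 with hβ
  set φ : ℕ → ℝ := fun v => 1 + α * v - β * v ^ 2 with hφ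
  have hφe : ∀ v : ℕ, 1 + (1500 : ℕ) * ((k * v : ℕ) : ℝ) / R ^ 2 -
      c * ((k * v : ℕ) : ℝ) ^ 2 / R ^ 3 = φ v := by
    intro v
    rw [hφ, hα, hβ]
    push_cast
    ring
  have hexp : ∀ v : ℕ, exp (-(c * ((k * v : ℕ) : ℝ) / R)) = z ^ v := by
    intro v
    rw [hz, ← exp_nat_mul, hy]
    congr 1
    push_cast
    ring
  simp_rw [hφe, hexp]
  have hφneg : ∀ v : ℕ, n ≤ k * v → φ v ≤ 0 := by
    intro v hv
    have hv' : R ^ 2 ≤ k * v := by rw [← hn]; exact_mod_cast hv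
    set ζ : ℝ := k * v / R ^ 2 with hζ
    have hζ1 : 1 ≤ ζ := by rw [hζ, le_div_iff₀ (by positivity)]; linarith
    have e : φ v = 1 + 1500 * ζ - c * R * ζ ^ 2 := by
      rw [hφ, hα, hβ, hζ]
      field_simp
    rw [e]
    have h1 : 1501 ≤ c * R := by nlinarith
    nlinarith [mul_le_mul_of_nonneg_right h1 (sq_nonneg ζ)]
  have hg : HasSum (fun i : ℕ => ((i + 1).choose 1 * z ^ i + α * ((i + 2).choose 2 * z ^ i) -
      6 * β * ((i + 3).choose 3 * z ^ i)) * z)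
      ((1 / (1 - z) ^ (1 + 1) + α * (1 / (1 - z) ^ (2 + 1)) -
        6 * β * (1 / (1 - z) ^ (3 + 1))) * z) := by
    have hz' : ‖z‖ < 1 := by rwa [norm_of_nonneg hz0.le]
    exact (((hasSum_choose_mul_geometric_of_norm_lt_one 1 hz').add
      ((hasSum_choose_mul_geometric_of_norm_lt_one 2 hz').mul_left α)).sub
      ((hasSum_choose_mul_geometric_of_norm_lt_one 3 hz').mul_left (6 * β))).mul_right z
  have hα0 : 0 ≤ α := by positivity
  have hβ0 : 0 ≤ β := by positivity
  have hterm : ∀ i : ℕ, ((i + 1).choose 1 * z ^ i + α * ((i + 2).choose 2 * z ^ i) -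
      6 * β * ((i + 3).choose 3 * z ^ i)) * z ≤ ((i + 1 : ℕ) : ℝ) * (z ^ (i + 1) * φ (i + 1)) := by
    intro i
    have e2 : 2 * (((i + 2).choose 2 : ℕ) : ℝ) = (i + 2) * (i + 1) := by
      have := Nat.choose_two_right (i + 2)
      rw [Nat.cast_choose_two]
      push_cast
      ring
    have e3 : 6 * (((i + 3).choose 3 : ℕ) : ℝ) = (i + 3) * ((i + 2) * (i + 1)) := by
      have h := Nat.add_one_mul_choose_eq (i + 2) 2
      have h' : ((i : ℝ) + 2 + 1) * ((i + 2).choose 2 : ℕ) = ((i + 3).choose 3 : ℕ) * (2 + 1) := by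
        exact_mod_cast h
      rw [← e2]
      linarith
    have hi : (0 : ℝ) ≤ i := by positivity
    have hb : ((i + 2).choose 2 : ℝ) ≤ ((i : ℝ) + 1) ^ 2 := by nlinarith
    have hb' : ((i : ℝ) + 1) ^ 3 ≤ 6 * ((i + 3).choose 3 : ℝ) := by
      rw [e3]
      nlinarith [pow_nonneg hi 2, pow_nonneg hi 3]
    have key : (((i + 1).choose 1 : ℕ) : ℝ) + α * ((i + 2).choose 2 : ℕ) -
        6 * β * ((i + 3).choose 3 : ℕ) ≤ ((i + 1 : ℕ) : ℝ) * φ (i + 1) := by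
      have h1 := mul_le_mul_of_nonneg_left hb hα0
      have h2 := mul_le_mul_of_nonneg_left hb' hβ0
      rw [hφ, Nat.choose_one_right]
      push_cast
      linarith
    have := mul_le_mul_of_nonneg_right key (show 0 ≤ z ^ (i + 1) by positivity)
    rw [pow_succ] at this ⊢
    linarith
  have hsum : (1 / (1 - z) ^ (1 + 1) + α * (1 / (1 - z) ^ (2 + 1)) -
        6 * β * (1 / (1 - z) ^ (3 + 1))) * z ≤
      ∑ v ∈ Finset.Icc 1 n, (v : ℝ) * (z ^ v * φ v) := by
    refine le_of_tendsto hg.tendsto_sum_nat ?_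
    filter_upwards [Filter.eventually_ge_atTop n] with N hN
    calc _ ≤ ∑ i ∈ Finset.range N, ((i + 1 : ℕ) : ℝ) * (z ^ (i + 1) * φ (i + 1)) :=
          Finset.sum_le_sum fun i _ => hterm i
      _ = ∑ v ∈ Finset.Icc 1 N, (v : ℝ) * (z ^ v * φ v) := by
          rw [Finset.range_eq_Ico, Finset.sum_Ico_add' (fun v : ℕ => (v : ℝ) * (z ^ v * φ v)) 0 N 1]
          rfl
      _ ≤ _ := by
          rw [← Finset.sum_sdiff (Finset.Icc_subset_Icc_right hN)]
          refine add_le_of_nonpos_left (Finset.sum_nonpos fun v hv => ?_)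
          have : n ≤ k * v := by
            rw [Finset.mem_sdiff, Finset.mem_Icc, Finset.mem_Icc] at hv
            have : n < v := by omega
            exact this.le.trans (Nat.le_mul_of_pos_left v hk)
          have := hφneg v this
          exact mul_nonpos_of_nonneg_of_nonpos (by positivity)
            (mul_nonpos_of_nonneg_of_nonpos (by positivity) this)
  have hfin : ∑ v ∈ Finset.Icc 1 n, (v : ℝ) * (z ^ v * φ v) ≤
      ∑ v ∈ Finset.Icc 1 n, if k * v < n then (v : ℝ) * (z ^ v * max (φ v) 0) else 0 := by
    refine Finset.sum_le_sum fun v _ => ?_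
    split_ifs with h
    · gcongr
      exact le_max_left _ _
    · exact mul_nonpos_of_nonneg_of_nonpos (by positivity)
        (mul_nonpos_of_nonneg_of_nonpos (by positivity) (hφneg v (not_lt.1 h)))
  refine le_trans ?_ (hsum.trans hfin)
  have hz1' : 0 < 1 - z := by linarith
  have b1 := inv_sq_sub_half_le hy0 hy1
  have b2 : 1 / (3 * y ^ 3) ≤ z / (1 - z) ^ 3 := by
    calc 1 / (3 * y ^ 3) = 1 / 3 / y ^ 3 := by field_simp
      _ ≤ z / (1 - z) ^ 3 := by gcongr
  have b3 : z / (1 - z) ^ 4 ≤ 81 / y ^ 4 := by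
    calc z / (1 - z) ^ 4 ≤ 1 / (y / 3) ^ 4 := by gcongr
      _ = 81 / y ^ 4 := by field_simp; norm_num
  have c2 := mul_le_mul_of_nonneg_left b2 hα0
  have c3 := mul_le_mul_of_nonneg_left b3 (show 0 ≤ 6 * β by positivity)
  have e1 : 1 / y ^ 2 = R ^ 2 / (c ^ 2 * k ^ 2) := by rw [hy]; field_simp
  have e2 : α * (1 / (3 * y ^ 3)) = 500 * R / (c ^ 3 * k ^ 2) := by
    rw [hα, hy]; field_simp; norm_num
  have e3 : 6 * β * (81 / y ^ 4) = 486 * R / (c ^ 3 * k ^ 2) := by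
    rw [hβ, hy]; field_simp; norm_num
  have e4 : 500 * R / (c ^ 3 * k ^ 2) - 486 * R / (c ^ 3 * k ^ 2) = 14 * R / (c ^ 3 * k ^ 2) := by
    ring
  have e5 : (1 / (1 - z) ^ (1 + 1) + α * (1 / (1 - z) ^ (2 + 1)) -
        6 * β * (1 / (1 - z) ^ (3 + 1))) * z =
      z / (1 - z) ^ 2 + α * (z / (1 - z) ^ 3) - 6 * β * (z / (1 - z) ^ 4) := by
    ring
  rw [e5]
  rw [e1] at b1
  rw [e2] at c2
  rw [e3] at c3
  linarith

lemma sq_le_sum_multiples {c R : ℝ} (hc : 1 ≤ c) (hc2 : c ^ 2 = π ^ 2 / 6) (hR : 1501 ≤ R) :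
    R ^ 2 ≤ ∑ k ∈ Finset.Icc 1 ⌊R / c⌋₊,
      (R ^ 2 / (c ^ 2 * k ^ 2) - 1 / 2 + 14 * R / (c ^ 3 * k ^ 2)) := by
  have hc0 : 0 < c := by linarith
  have hR0 : 0 < R := by linarith
  have hc2' : c ^ 2 ≤ 2 := by
    rw [hc2]
    nlinarith [pi_lt_d2, pi_pos]
  have hc' : c ≤ 2 := by nlinarith
  have hRc : 2 ≤ R / c := by rw [le_div_iff₀ hc0]; linarith
  set Y := ⌊R / c⌋₊ with hY
  have hY1 : (Y : ℝ) ≤ R / c := Nat.floor_le (by positivity)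
  have hY2 : R / c - 1 < Y := Nat.sub_one_lt_floor _
  have hY3 : R / (2 * c) ≤ Y := by
    have : R / (2 * c) = R / c / 2 := by field_simp
    rw [this]
    linarith
  have hY0 : 0 < Y := by
    have : (0 : ℝ) < Y := by linarith
    exact_mod_cast this
  have hS := pi_sq_div_six_le_sum Y hY0.ne'
  set S := ∑ k ∈ Finset.Icc 1 Y, 1 / (k : ℝ) ^ 2 with hSdef
  have hS1 : 1 ≤ S := by
    have := Finset.single_le_sum (f := fun k : ℕ => 1 / (k : ℝ) ^ 2) (s := Finset.Icc 1 Y)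
      (fun k _ => by positivity) (Finset.mem_Icc.2 ⟨le_rfl, hY0⟩)
    rw [hSdef]
    simpa using this
  have e : ∑ k ∈ Finset.Icc 1 Y, (R ^ 2 / (c ^ 2 * k ^ 2) - 1 / 2 + 14 * R / (c ^ 3 * k ^ 2)) =
      R ^ 2 / c ^ 2 * S - Y / 2 + 14 * R / c ^ 3 * S := by
    rw [Finset.sum_add_distrib, Finset.sum_sub_distrib, hSdef, Finset.mul_sum, Finset.mul_sum]
    congr 1
    · congr 1
      · refine Finset.sum_congr rfl fun k _ => ?_
        rw [div_mul_div_comm, mul_one]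
      · simp
        ring
    · refine Finset.sum_congr rfl fun k _ => ?_
      rw [div_mul_div_comm, mul_one]
  rw [e]
  rw [← hc2] at hS
  have h1 : R ^ 2 - 2 * (R / c) ≤ R ^ 2 / c ^ 2 * S := by
    have hY4 : 1 / (Y : ℝ) ≤ 2 * c / R := by
      rw [div_le_div_iff₀ (by exact_mod_cast hY0) hR0]
      rw [div_le_iff₀ (by positivity)] at hY3
      linarith
    have h2 : c ^ 2 - 2 * c / R ≤ S := by linarith
    calc R ^ 2 - 2 * (R / c) = R ^ 2 / c ^ 2 * (c ^ 2 - 2 * c / R) := by field_simp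
      _ ≤ _ := by gcongr
  have h3 : 7 * (R / c) ≤ 14 * R / c ^ 3 * S := by
    calc 7 * (R / c) ≤ 14 * R / c ^ 3 * 1 := by
          have : 14 * R / c ^ 3 * 1 = 14 / c ^ 2 * (R / c) := by field_simp
          rw [this]
          gcongr
          rw [le_div_iff₀ (by positivity)]
          linarith
      _ ≤ _ := by gcongr
  have : 0 < R / c := by positivity
  linarith

/-- A lower bound for the number of partitions of `n`, sharp up to a power of `n`. -/
lemma exists_exp_sqrt_div_pow_le_card_partition {c : ℝ} (hc : 1 ≤ c) (hc2 : c ^ 2 = π ^ 2 / 6) :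
    ∃ A : ℝ, 0 < A ∧ ∀ n : ℕ, 0 < n →
      A * (exp (2 * c * √n) / (n : ℝ) ^ 1500) ≤ Fintype.card n.Partition := by
  refine ⟨exp (-(2 * c * 1501)), exp_pos _, fun n => ?_⟩
  set A := exp (-(2 * c * 1501)) with hA
  have hA0 : 0 < A := exp_pos _
  induction n using Nat.strong_induction_on with
  | _ n ih =>
  intro hn
  have hn0 : (0 : ℝ) < n := by exact_mod_cast hn
  set R := √(n : ℝ) with hR
  have hRn : (n : ℝ) = R ^ 2 := (sq_sqrt hn0.le).symm
  rcases lt_or_ge R 1501 with hlt | hge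
  · have h1 : (1 : ℝ) ≤ Fintype.card n.Partition := by
      exact_mod_cast Fintype.card_pos
    refine le_trans ?_ h1
    have h2 : A * exp (2 * c * R) ≤ 1 := by
      rw [hA, ← exp_add]
      refine exp_le_one_iff.2 ?_
      nlinarith
    calc A * (exp (2 * c * R) / (n : ℝ) ^ 1500) ≤ A * (exp (2 * c * R) / 1) := by
          gcongr
          exact one_le_pow₀ (by exact_mod_cast hn)
      _ ≤ 1 := by rwa [div_one]
  · have hR0 : 0 < R := by linarith
    set G := exp (2 * c * R) / (n : ℝ) ^ 1500 with hG
    have hG0 : 0 < G := by positivity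
    set Y := ⌊R / c⌋₊ with hY
    have hYn : Y ≤ n := by
      have h1 : (Y : ℝ) ≤ R / c := Nat.floor_le (by positivity)
      have h2 : R / c ≤ R := div_le_self hR0.le hc
      have h3 : R ≤ R ^ 2 := by nlinarith
      rw [← hRn] at h3
      exact_mod_cast h1.trans (h2.trans h3)
    set ψ : ℕ → ℝ := fun u => exp (-(c * (u : ℝ) / R)) *
          max (1 + (1500 : ℕ) * (u : ℝ) / R ^ 2 - c * (u : ℝ) ^ 2 / R ^ 3) 0 with hψ
    have hψ0 : ∀ u, 0 ≤ ψ u := fun u => mul_nonneg (exp_pos _).le (le_max_right _ _)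
    have hstep : ∀ u, 0 < u → u < n → A * (G * ψ u) ≤ Fintype.card (n - u).Partition := by
      intro u hu0 hu
      refine le_trans ?_ (ih (n - u) (by omega) (by omega))
      have hcast : ((n - u : ℕ) : ℝ) = R ^ 2 - u := by
        rw [Nat.cast_sub hu.le, hRn]
      rw [hcast, hG, hRn]
      gcongr
      refine exp_sqrt_div_pow_sub_ge (by linarith) hR0 (Nat.cast_nonneg u) ?_ 1500
      rw [← hRn]
      exact_mod_cast hu
    have hrec : (n : ℝ) * (A * G) ≤ n * Fintype.card n.Partition := by
      calc (n : ℝ) * (A * G) ≤ (∑ k ∈ Finset.Icc 1 Y, (R ^ 2 / (c ^ 2 * k ^ 2) - 1 / 2 +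
              14 * R / (c ^ 3 * k ^ 2))) * (A * G) := by
            rw [hRn]
            gcongr
            exact sq_le_sum_multiples hc hc2 hge
        _ ≤ (∑ k ∈ Finset.Icc 1 Y, ∑ v ∈ Finset.Icc 1 n,
              if k * v < n then (v : ℝ) * ψ (k * v) else 0) * (A * G) := by
            gcongr with k hk
            rw [Finset.mem_Icc] at hk
            refine sum_multiples_ge hc hge hRn hk.1 ?_
            have h1 : (k : ℝ) ≤ R / c :=
              (Nat.cast_le.2 hk.2).trans (Nat.floor_le (by positivity))
            rwa [le_div_iff₀ (by linarith), mul_comm] at h1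
        _ ≤ (∑ k ∈ Finset.Icc 1 n, ∑ v ∈ Finset.Icc 1 n,
              if k * v < n then (v : ℝ) * ψ (k * v) else 0) * (A * G) := by
            refine mul_le_mul_of_nonneg_right (Finset.sum_le_sum_of_subset_of_nonneg
              (Finset.Icc_subset_Icc_right hYn) fun k _ _ => Finset.sum_nonneg fun v _ => ?_)
              (by positivity)
            split_ifs
            · exact mul_nonneg (Nat.cast_nonneg _) (hψ0 _)
            · exact le_rfl
        _ ≤ ∑ k ∈ Finset.Icc 1 n, ∑ v ∈ Finset.Icc 1 n, (if k * v ≤ n then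
              (v : ℝ) * Fintype.card (n - k * v).Partition else 0) := by
            rw [Finset.sum_mul]
            gcongr with k hk
            rw [Finset.sum_mul]
            gcongr with v hv
            split_ifs with h1 h2 h2
            · rw [mul_assoc, mul_comm (ψ _), mul_assoc A]
              gcongr
              exact hstep _ (Nat.mul_pos (Finset.mem_Icc.1 hk).1 (Finset.mem_Icc.1 hv).1) h1
            · omega
            · rw [zero_mul]
              positivity
            · simp
        _ ≤ _ := by
            exact_mod_cast sum_mul_card_partition_le n
    exact le_of_mul_le_mul_left hrec hn0

lemma factorial_mul_two_pow_le (r : ℕ) : r.factorial * 2 ^ r ≤ 2 * r ^ r := by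
  induction r with
  | zero => simp
  | succ r ih =>
    rcases Nat.eq_zero_or_pos r with rfl | hr
    · simp
    have h1 : 2 * r ^ r ≤ (r + 1) ^ r := by
      have h2 : (r + 1) ^ r = (r + 1) * (r + 1) ^ (r - 1) := by
        rw [← pow_succ', Nat.sub_add_cancel hr]
      have h := one_add_mul_le_pow (show (-2 : ℝ) ≤ 1 / r by
        have : (0 : ℝ) ≤ 1 / r := by positivity
        linarith) r
      have hr0 : (0 : ℝ) < r := by exact_mod_cast hr
      have h3 : (2 : ℝ) * r ^ r ≤ (r + 1) ^ r := by
        calc (2 : ℝ) * r ^ r = (1 + r * (1 / r)) * r ^ r := by field_simp; norm_num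
          _ ≤ (1 + 1 / r) ^ r * r ^ r := by gcongr
          _ = (r + 1) ^ r := by rw [← mul_pow]; congr 1; field_simp
      exact_mod_cast h3
    calc (r + 1).factorial * 2 ^ (r + 1) = 2 * (r + 1) * (r.factorial * 2 ^ r) := by
          rw [Nat.factorial_succ]; ring
      _ ≤ 2 * (r + 1) * (2 * r ^ r) := by gcongr
      _ ≤ 2 * (r + 1) * (r + 1) ^ r := by gcongr
      _ = _ := by ring

lemma two_rpow_div_four_le {X : ℝ} (hX : 0 ≤ X) :
    exp (X * log 2) / 4 ≤ X ^ ⌊X⌋₊ / (⌊X⌋₊).factorial := by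
  set r := ⌊X⌋₊ with hr
  have h1 : (r : ℝ) ≤ X := Nat.floor_le hX
  have h2 : X < r + 1 := Nat.lt_floor_add_one X
  have h3 : ((r.factorial : ℝ)) * 2 ^ r ≤ 2 * r ^ r := by
    exact_mod_cast factorial_mul_two_pow_le r
  have h4 : exp (X * log 2) ≤ 2 * 2 ^ r := by
    have : (2 : ℝ) * 2 ^ r = exp (((r + 1 : ℕ) : ℝ) * log 2) := by
      rw [exp_nat_mul, exp_log two_pos, pow_succ']
    rw [this]
    refine exp_le_exp.2 (mul_le_mul_of_nonneg_right ?_ (log_nonneg one_le_two))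
    push_cast
    exact h2.le
  rw [div_le_div_iff₀ (by norm_num) (by positivity)]
  calc exp (X * log 2) * r.factorial ≤ 2 * 2 ^ r * r.factorial := by gcongr
    _ = 2 * (r.factorial * 2 ^ r) := by ring
    _ ≤ 2 * (2 * r ^ r) := by gcongr
    _ ≤ 2 * (2 * X ^ r) := by gcongr
    _ = X ^ r * 4 := by ring

lemma saving_exponent_ge {a : ℝ} (ha : 0 ≤ a) (ha2 : a ≤ 1 / 2) :
    a / 10 ≤ 1 / 2 - (1 + a / 5) / 2 * (1 + a / 10) * (1 + a ^ 4) +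
      a * ((1 + a / 5) / 2) * log 2 := by
  have h4 : a ^ 4 ≤ a / 8 := by
    have : a ^ 3 ≤ (1 / 2) ^ 3 := by gcongr
    nlinarith
  have h1 : (1 + a / 5) / 2 * (1 + a / 10) * (1 + a ^ 4) ≤
      (1 + a / 5) / 2 * (1 + a / 10) * (1 + a / 8) := by gcongr
  have h2 : a * ((1 + a / 5) / 2) * 0.69 ≤ a * ((1 + a / 5) / 2) * log 2 := by
    gcongr
    linarith [log_two_gt_d9]
  have h3 : a ^ 2 ≤ a / 2 := by nlinarith
  have h5 : a ^ 3 ≤ a / 4 := by nlinarith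
  nlinarith

lemma log_natCast_le_half {p : ℕ} (hp : 2 ≤ p) : log p ≤ p / 2 := by
  have hp0 : (0 : ℝ) < p := by positivity
  have h := log_le_sub_one_of_pos (show (0 : ℝ) < p / 2 by positivity)
  rw [log_div hp0.ne' two_ne_zero] at h
  linarith [log_two_lt_d9]

/-- The threshold for the largest part, as a function of the (real) size. -/
noncomputable def threshold (p : ℕ) (x : ℝ) : ℝ :=
  √6 / (2 * π) * √x * log x * (1 + 1 / (5 * p))

set_option maxHeartbeats 1000000 in
lemma card_powSum_lt_threshold_le {c : ℝ} (hc : 1 ≤ c) (hc2 : c = π / √6) {p n : ℕ}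
    (hp : 2 ≤ p) (hn : 0 < n) (hL : 1 ≤ log n) (hbig : 80 * (p : ℝ) ^ 6 ≤ exp (log n / 5))
    (F : Finset n.Partition)
    (hF : ∀ l ∈ F, ∀ m J : ℕ, 0 < m → threshold p n ≤ m * p ^ J →
      powSum p m l.parts < m * p ^ J) :
    (F.card : ℝ) ≤ exp (2 * c * √n) *
      exp (-(1 / (320 * (p : ℝ) ^ 6) * exp (log n * (1 / (10 * p))))) := by
  have hn0 : (0 : ℝ) < n := by exact_mod_cast hn
  have hp2 : (2 : ℝ) ≤ p := by exact_mod_cast hp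
  have hp0 : (0 : ℝ) < p := by linarith
  have hc0 : 0 < c := by linarith
  have hcsq : c ^ 2 = π ^ 2 / 6 := by rw [hc2, div_pow, sq_sqrt (by norm_num)]
  have hc2' : c ≤ 2 := by nlinarith [pi_lt_d2, pi_pos]
  set R := √(n : ℝ) with hR
  have hRn : (n : ℝ) = R ^ 2 := (sq_sqrt hn0.le).symm
  have hR0 : 0 < R := sqrt_pos.2 hn0
  set L := log (n : ℝ) with hLdef
  have hRL : R = exp (L / 2) := by
    rw [hR, sqrt_eq_rpow, rpow_def_of_pos hn0, ← hLdef]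
    congr 1
    ring
  set a : ℝ := 1 / p with ha
  have ha0 : 0 < a := by positivity
  have hap : a * p = 1 := by rw [ha]; field_simp
  have ha2 : a ≤ 1 / 2 := by rw [ha]; gcongr
  set b := (1 + a / 5) / 2 with hb
  have hb0 : 1 / 2 ≤ b := by rw [hb]; linarith
  set T := threshold p n with hT
  have hTeq : T = R * L * b / c := by
    have : √6 ≠ 0 := by positivity
    rw [hT, threshold, hc2, hb, ha, ← hR, ← hLdef]
    field_simp
  have hT0 : R / 4 ≤ T := by
    rw [hTeq, le_div_iff₀ hc0]
    have : 1 * (1 / 2) ≤ L * b := by gcongr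
    nlinarith
  have hTpos : 0 < T := by linarith
  set t := c / R with ht
  have ht0 : 0 < t := by positivity
  have htT : t * T = b * L := by rw [ht, hTeq]; field_simp
  set X := a * b * L with hX
  have hX0 : 0 ≤ X := by positivity
  set r := ⌊X⌋₊ with hr
  have hrX : (r : ℝ) ≤ X := Nat.floor_le hX0
  set s := p ^ (r + 5) with hs
  have hs0 : (0 : ℝ) < s := by rw [hs]; push_cast; positivity
  have hsc : (s : ℝ) = p ^ r * p ^ 5 := by rw [hs]; push_cast; rw [pow_add]
  set η := a / 10 with hη
  have hη0 : 0 < η := by positivity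
  set Q := T / s with hQ
  have hQ0 : 0 < Q := by positivity
  have hηQ : 2 ≤ η * Q := by
    have hpr : (p : ℝ) ^ r ≤ exp (L * (3 / 10)) := by
      rw [← exp_log hp0, ← exp_nat_mul]
      refine exp_le_exp.2 ?_
      calc (r : ℝ) * log p ≤ X * (p / 2) := by
            gcongr
            exact log_natCast_le_half hp
        _ = (a * p) * (b / 2) * L := by rw [hX]; ring
        _ ≤ L * (3 / 10) := by
          rw [hap]
          have : b / 2 ≤ 3 / 10 := by rw [hb]; linarith
          nlinarith
    have h1 : η * Q = η * T / (p ^ r * p ^ 5) := by rw [hQ, hsc]; ring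
    rw [h1, le_div_iff₀ (by positivity)]
    have h2 : exp (L / 5) * exp (L * (3 / 10)) = R := by
      rw [hRL, ← exp_add]; congr 1; ring
    have h3 : a * (p : ℝ) ^ 6 = p ^ 5 := by
      calc a * (p : ℝ) ^ 6 = (a * p) * p ^ 5 := by ring
        _ = _ := by rw [hap, one_mul]
    calc 2 * ((p : ℝ) ^ r * p ^ 5) ≤ 2 * (exp (L * (3 / 10)) * p ^ 5) := by gcongr
      _ = a / 40 * (80 * p ^ 6) * exp (L * (3 / 10)) := by rw [← h3]; ring
      _ ≤ a / 40 * exp (L / 5) * exp (L * (3 / 10)) := by gcongr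
      _ = η * (R / 4) := by rw [mul_assoc, h2, hη]; ring
      _ ≤ η * T := by gcongr
  have hη1 : η ≤ 1 / 20 := by rw [hη]; linarith
  set I := Finset.Icc ⌈Q⌉₊ ⌊(1 + η) * Q⌋₊ with hI
  have hlow : ∀ m ∈ I, Q ≤ (m : ℝ) := fun m hm =>
    (Nat.le_ceil _).trans (Nat.cast_le.2 (Finset.mem_Icc.1 hm).1)
  have hup : ∀ m ∈ I, (m : ℝ) ≤ (1 + η) * Q := fun m hm =>
    (Nat.cast_le.2 (Finset.mem_Icc.1 hm).2).trans (Nat.floor_le (by positivity))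
  have hIpos : ∀ m ∈ I, 0 < m := fun m hm => by
    have : (0 : ℝ) < m := hQ0.trans_le (hlow m hm)
    exact_mod_cast this
  have hne : ∀ x ∈ I, ∀ y ∈ I, ∀ i j, i < j → x * p ^ i ≠ y * p ^ j := by
    intro x hx y hy i j hij h
    obtain ⟨d, rfl⟩ := Nat.exists_eq_add_of_lt hij
    have h1 : x = y * p ^ (d + 1) := by
      have : x * p ^ i = y * p ^ (d + 1) * p ^ i := by rw [h]; ring
      exact Nat.eq_of_mul_eq_mul_right (by positivity) this
    have h2 : y * 2 ≤ x := by
      rw [h1]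
      refine Nat.mul_le_mul_left _ (hp.trans ?_)
      exact Nat.le_self_pow (by omega) p
    have h3 : (y : ℝ) * 2 ≤ x := by exact_mod_cast h2
    have := hlow y hy
    have := hup x hx
    nlinarith
  have hdisj : ∀ x ∈ I, ∀ y ∈ I, x ≠ y → ∀ i j, x * p ^ i ≠ y * p ^ j := by
    intro x hx y hy hxy i j h
    rcases lt_trichotomy i j with hij | rfl | hij
    · exact hne x hx y hy i j hij h
    · exact hxy (Nat.eq_of_mul_eq_mul_right (by positivity) h)
    · exact hne y hy x hx j i hij h.symm
  have hlow' : ∀ m ∈ I, T ≤ m * s := fun m hm => by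
    have := hlow m hm
    rwa [hQ, div_le_iff₀ hs0] at this
  have hup' : ∀ m ∈ I, (m : ℝ) * s ≤ (1 + η) * T := fun m hm => by
    have h := mul_le_mul_of_nonneg_right (hup m hm) hs0.le
    have e : (1 + η) * Q * s = (1 + η) * T := by rw [hQ]; field_simp
    rwa [e] at h
  have hmain := card_powSum_lt_le ht0 hp r s n I hIpos hdisj F fun l hl m hm => by
    refine hF l hl m (r + 5) (hIpos m hm) ?_
    have := hlow' m hm
    rw [hs] at this
    exact_mod_cast this
  have hfirst : exp (t * n) * exp (π ^ 2 / (6 * t)) = exp (2 * c * R) := by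
    rw [← exp_add]
    congr 1
    have : π ^ 2 / (6 * t) = c ^ 2 / t := by rw [hcsq]; field_simp
    rw [this, hRn, ht]
    field_simp
    ring
  rw [hfirst] at hmain
  refine hmain.trans ?_
  gcongr
  have hXr : exp (X * log 2) / 4 ≤ X ^ r / r.factorial := two_rpow_div_four_le hX0
  obtain ⟨κ, hκ⟩ : ∃ κ, κ = b * (1 + η) * (1 + a ^ 4) := ⟨_, rfl⟩
  clear_value Q s r X t T η b a R L
  have hterm : ∀ m ∈ I, exp (-(κ * L)) * (p ^ r * (exp (X * log 2) / 4)) ≤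
      exp (-(t * m * (s + p ^ (r + 1)))) * (t * m * s) ^ r / r.factorial := by
    intro m hm
    have hps : (p : ℝ) ^ (r + 1) = a ^ 4 * s := by
      rw [hsc]
      calc (p : ℝ) ^ (r + 1) = (a * p) ^ 4 * p ^ (r + 1) := by rw [hap]; ring
        _ = _ := by ring
    have h1 : t * m * (s + p ^ (r + 1)) ≤ κ * L := by
      rw [hps]
      calc t * m * (s + a ^ 4 * s) = t * (m * s) * (1 + a ^ 4) := by ring
        _ ≤ t * ((1 + η) * T) * (1 + a ^ 4) := by
          exact mul_le_mul_of_nonneg_right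
            (mul_le_mul_of_nonneg_left (hup' m hm) ht0.le) (by positivity)
        _ = (t * T) * (1 + η) * (1 + a ^ 4) := by ring
        _ = κ * L := by rw [htT, hκ]; ring
    have h2 : X * p ≤ t * m * s := by
      calc X * p = (a * p) * (b * L) := by rw [hX]; ring
        _ = t * T := by rw [hap, htT, one_mul]
        _ ≤ t * (m * s) := by
          gcongr
          exact hlow' m hm
        _ = _ := by ring
    calc exp (-(κ * L)) * (p ^ r * (exp (X * log 2) / 4))
        ≤ exp (-(κ * L)) * (p ^ r * (X ^ r / r.factorial)) := by
          exact mul_le_mul_of_nonneg_left (mul_le_mul_of_nonneg_left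
            hXr (by positivity)) (exp_pos _).le
      _ = exp (-(κ * L)) * (X * p) ^ r / r.factorial := by
          ring
      _ ≤ _ := by gcongr
  have hcard : η / 2 * Q ≤ (I.card : ℝ) := by
    have h1 : (1 + η) * Q - 1 < ⌊(1 + η) * Q⌋₊ := Nat.sub_one_lt_floor _
    have h2 : (⌈Q⌉₊ : ℝ) < Q + 1 := Nat.ceil_lt_add_one hQ0.le
    have h3 : ((⌊(1 + η) * Q⌋₊ : ℝ) + 1) - ⌈Q⌉₊ ≤ I.card := by
      rw [hI, Nat.card_Icc]
      have h4 : ⌊(1 + η) * Q⌋₊ + 1 ≤ (⌊(1 + η) * Q⌋₊ + 1 - ⌈Q⌉₊) + ⌈Q⌉₊ := by omega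
      have h5 : ((⌊(1 + η) * Q⌋₊ : ℝ) + 1) ≤
        ((⌊(1 + η) * Q⌋₊ + 1 - ⌈Q⌉₊ : ℕ) : ℝ) + ⌈Q⌉₊ := by exact_mod_cast h4
      linarith
    linarith
  calc 1 / (320 * (p : ℝ) ^ 6) * exp (L * (1 / (10 * p)))
      = a / (320 * p ^ 5) * exp (L * (a / 10)) := by
        rw [ha]; field_simp
    _ ≤ a / (320 * p ^ 5) * exp (L * (1 / 2 - κ + a * b * log 2)) := by
        gcongr
        rw [hκ, hη, hb]
        exact saving_exponent_ge ha0.le ha2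
    _ = a / (320 * p ^ 5) * (exp (L / 2) * exp (-(κ * L)) * exp (X * log 2)) := by
        rw [← exp_add, ← exp_add, hX]
        congr 2
        ring
    _ = η / 2 * ((R / 4) / s) * (exp (-(κ * L)) * (p ^ r * (exp (X * log 2) / 4))) := by
        have key : ∀ u v w x y : ℝ, 0 < u → 0 < v → a / (320 * v) * (w * x * y) =
            a / 10 / 2 * (w / 4 / (u * v)) * (x * (u * (y / 4))) := by
          intro u v w x y hu hv
          field_simp
          ring
        rw [hsc, ← hRL, hη]
        exact key _ _ _ _ _ (by positivity) (by positivity)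
    _ ≤ η / 2 * Q * (exp (-(κ * L)) * (p ^ r * (exp (X * log 2) / 4))) := by
        gcongr
        rw [hQ]
        gcongr
    _ ≤ I.card * (exp (-(κ * L)) * (p ^ r * (exp (X * log 2) / 4))) := by gcongr
    _ ≤ _ := by
        rw [← nsmul_eq_mul]
        exact Finset.card_nsmul_le_sum I _ _ hterm

lemma eventually_exp_add_mul_le {u v K : ℝ} (B : ℝ) (hv : 0 < v) (huv : u < v) (hK : 0 < K) :
    ∀ᶠ x : ℝ in Filter.atTop, exp (x * u) + B * x ≤ K * exp (x * v) := by
  have h1 : (fun x : ℝ => exp (x * u)) =o[Filter.atTop] fun x => exp (x * v) := by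
    refine isLittleO_exp_comp_exp_comp.2 ?_
    simp_rw [← mul_sub]
    exact Filter.tendsto_id.atTop_mul_const (by linarith)
  have h2 : (fun x : ℝ => B * x) =o[Filter.atTop] fun x => exp (x * v) := by
    have := (isLittleO_pow_exp_pos_mul_atTop 1 hv).const_mul_left B
    simpa [mul_comm v] using this
  filter_upwards [(h1.add h2).bound hK] with x hx
  rw [norm_of_nonneg (exp_pos _).le] at hx
  exact (le_norm_self _).trans hx

/-- All but an exponentially small proportion of the partitions of `n` have a chain `m * p ^ j`
carrying total size at least `m * p ^ J`, for some `m * p ^ J` above the threshold. -/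
lemma exists_card_powSum_lt_threshold_le {p : ℕ} (hp : 2 ≤ p) :
    ∃ C : ℝ, 0 < C ∧ ∀ (n : ℕ) (F : Finset n.Partition),
      (∀ l ∈ F, ∀ m J : ℕ, 0 < m → threshold p n ≤ m * p ^ J →
        powSum p m l.parts < m * p ^ J) →
      (F.card : ℝ) ≤ C * exp (-((n : ℝ) ^ ((1 : ℝ) / (15 * p)))) * Fintype.card n.Partition := by
  have hp0 : (0 : ℝ) < p := by positivity
  obtain ⟨c, hc2⟩ : ∃ c, c = π / √6 := ⟨_, rfl⟩
  have hcsq : c ^ 2 = π ^ 2 / 6 := by rw [hc2, div_pow, sq_sqrt (by norm_num)]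
  have hc0 : 0 ≤ c := by rw [hc2]; positivity
  have hc : 1 ≤ c := by nlinarith [pi_gt_three]
  obtain ⟨A, hA, hpart⟩ := exists_exp_sqrt_div_pow_le_card_partition hc hcsq
  set K : ℝ := 1 / (320 * (p : ℝ) ^ 6) with hK
  have hev : ∀ᶠ x : ℝ in Filter.atTop, 1 ≤ x ∧ 80 * (p : ℝ) ^ 6 ≤ exp (x / 5) ∧
      exp (x * (1 / (15 * p))) + 1500 * x ≤ K * exp (x * (1 / (10 * p))) := by
    refine (Filter.eventually_ge_atTop 1).and (.and ?_ ?_)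
    · exact (tendsto_exp_atTop.comp (Filter.tendsto_id.atTop_div_const
        (by norm_num))).eventually_ge_atTop _
    · refine eventually_exp_add_mul_le _ (by positivity) ?_ (by positivity)
      gcongr
      norm_num
  obtain ⟨n₀, hn₀⟩ := Filter.eventually_atTop.1 <|
    (tendsto_log_atTop.comp tendsto_natCast_atTop_atTop).eventually hev
  set e : ℝ := (1 : ℝ) / (15 * p) with he
  have he0 : 0 < e := by positivity
  refine ⟨max A⁻¹ (exp ((n₀ : ℝ) ^ e)), lt_max_of_lt_right (exp_pos _), fun n F hF => ?_⟩
  rcases lt_or_ge n (max n₀ 1) with hlt | hge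
  · have hle : n ≤ n₀ := by
      rcases lt_max_iff.1 hlt with h | h <;> omega
    have h1 : (F.card : ℝ) ≤ Fintype.card n.Partition := by exact_mod_cast F.card_le_univ
    have h2 : 1 ≤ max A⁻¹ (exp ((n₀ : ℝ) ^ e)) * exp (-((n : ℝ) ^ e)) := by
      calc (1 : ℝ) ≤ exp ((n₀ : ℝ) ^ e) * exp (-((n : ℝ) ^ e)) := by
            rw [← exp_add]
            refine one_le_exp ?_
            have : (n : ℝ) ^ e ≤ (n₀ : ℝ) ^ e := by gcongr
            linarith
        _ ≤ _ := by
            gcongr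
            exact le_max_right _ _
    nlinarith [Nat.cast_nonneg (α := ℝ) (Fintype.card n.Partition)]
  · obtain ⟨hge0, hge1⟩ := max_le_iff.1 hge
    obtain ⟨hL, hbig, hlast⟩ := hn₀ n hge0
    simp only [Function.comp_apply] at hL hbig hlast
    have hn0 : (0 : ℝ) < n := by exact_mod_cast hge1
    have h1 := card_powSum_lt_threshold_le hc hc2 hp hge1 hL hbig F hF
    have h2 : exp (2 * c * √n) ≤ A⁻¹ * (exp (1500 * log n) * Fintype.card n.Partition) := by
      have h3 := hpart n hge1
      have h4 : (n : ℝ) ^ 1500 = exp (1500 * log n) := by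
        rw [mul_comm, exp_mul, exp_log hn0]
        exact (rpow_natCast _ 1500).symm
      rw [h4, mul_div_assoc', div_le_iff₀ (exp_pos _)] at h3
      rw [le_inv_mul_iff₀ hA]
      linarith
    calc (F.card : ℝ) ≤ _ := h1
      _ ≤ A⁻¹ * (exp (1500 * log n) * Fintype.card n.Partition) *
          exp (-(exp (log n * e) + 1500 * log n)) := by
          gcongr
      _ = A⁻¹ * exp (-((n : ℝ) ^ e)) * Fintype.card n.Partition := by
          rw [rpow_def_of_pos hn0, neg_add, exp_add, exp_neg (1500 * log n)]
          field_simp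
      _ ≤ _ := by
          gcongr
          exact le_max_left _ _

lemma threshold_nonpos {p : ℕ} {x : ℝ} (hx0 : 0 ≤ x) (hx : x ≤ 1) : threshold p x ≤ 0 := by
  unfold threshold
  refine mul_nonpos_of_nonpos_of_nonneg (mul_nonpos_of_nonneg_of_nonpos (by positivity)
    (log_nonpos hx0 hx)) (by positivity)

lemma threshold_mono {p : ℕ} {x y : ℝ} (hx : 1 ≤ x) (hxy : x ≤ y) :
    threshold p x ≤ threshold p y := by
  have : 0 ≤ log x := log_nonneg hx
  unfold threshold
  gcongr

/-- Multipartitions with components in prescribed sets, sorted by the sizes of the components. -/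
def multipartitionEquiv (k N : ℕ) (S : Fin k → ∀ n : ℕ, Finset n.Partition) :
    { μ : Multipartition k N // ∀ j, (μ.1 j).2 ∈ S j (μ.1 j).1 } ≃
      Σ n : Finset.piAntidiag (Finset.univ : Finset (Fin k)) N, ∀ j, S j (n.1 j) where
  toFun μ := ⟨⟨fun j => (μ.1.1 j).1, by simpa using μ.1.2⟩, fun j => ⟨(μ.1.1 j).2, μ.2 j⟩⟩
  invFun x := ⟨⟨fun j => ⟨x.1.1 j, (x.2 j).1⟩,
    (Finset.mem_piAntidiag.1 x.1.2).1⟩, fun j => (x.2 j).2⟩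
  left_inv _ := rfl
  right_inv _ := rfl

lemma card_multipartition_mem (k N : ℕ) (S : Fin k → ∀ n : ℕ, Finset n.Partition) :
    Nat.card { μ : Multipartition k N // ∀ j, (μ.1 j).2 ∈ S j (μ.1 j).1 } =
      ∑ n ∈ Finset.piAntidiag (Finset.univ : Finset (Fin k)) N, ∏ j, (S j (n j)).card := by
  rw [Nat.card_congr (multipartitionEquiv k N S), Nat.card_eq_fintype_card, Fintype.card_sigma]
  simp only [Fintype.card_pi, Fintype.card_coe]
  exact Finset.sum_coe_sort _ fun n : Fin k → ℕ => ∏ j, (S j (n j)).card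

lemma card_multipartition (k N : ℕ) :
    Nat.card (Multipartition k N) =
      ∑ n ∈ Finset.piAntidiag (Finset.univ : Finset (Fin k)) N,
        ∏ j, Fintype.card (n j).Partition := by
  rw [← Nat.card_congr (Equiv.subtypeUnivEquiv (p := fun μ : Multipartition k N =>
    ∀ j, (μ.1 j).2 ∈ Finset.univ) fun _ _ => Finset.mem_univ _)]
  exact card_multipartition_mem k N fun _ _ => Finset.univ

instance (k N : ℕ) : Finite (Multipartition k N) :=
  Finite.of_equiv _ ((multipartitionEquiv k N fun _ _ => Finset.univ).symm.trans
    (Equiv.subtypeUnivEquiv fun _ _ => Finset.mem_univ _))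

lemma card_le_of_exists_component {k N : ℕ} {ε : ℝ} (S : ∀ n : ℕ, Finset n.Partition)
    (hS : ∀ n, ((S n).card : ℝ) ≤ ε * Fintype.card n.Partition) (P : Multipartition k N → Prop)
    (hP : ∀ μ, P μ → ∃ i, (μ.1 i).2 ∈ S (μ.1 i).1) :
    (Nat.card { μ // P μ } : ℝ) ≤ k * (ε * Nat.card (Multipartition k N)) := by
  classical
  let S' : Fin k → Fin k → ∀ n : ℕ, Finset n.Partition := fun i j n =>
    if j = i then S n else Finset.univ
  have hi : ∀ i, (Nat.card { μ : Multipartition k N // ∀ j, (μ.1 j).2 ∈ S' i j (μ.1 j).1 } : ℝ) ≤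
      ε * Nat.card (Multipartition k N) := by
    intro i
    rw [card_multipartition_mem, card_multipartition]
    push_cast
    rw [Finset.mul_sum]
    refine Finset.sum_le_sum fun n _ => ?_
    rw [← Finset.mul_prod_erase _ _ (Finset.mem_univ i),
      ← Finset.mul_prod_erase (a := i) _ _ (Finset.mem_univ i), ← mul_assoc]
    have h1 : S' i i (n i) = S (n i) := if_pos rfl
    have h2 : ∏ j ∈ Finset.univ.erase i, ((S' i j (n j)).card : ℝ) =
        ∏ j ∈ Finset.univ.erase i, (Fintype.card (n j).Partition : ℝ) :=
      Finset.prod_congr rfl fun j hj => by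
        rw [show S' i j (n j) = Finset.univ from if_neg (Finset.ne_of_mem_erase hj),
          Finset.card_univ]
    rw [h1, h2]
    gcongr
    exact hS _
  choose i hi' using hP
  have hinj : Nat.card { μ // P μ } ≤
      Nat.card (Σ i, { μ : Multipartition k N // ∀ j, (μ.1 j).2 ∈ S' i j (μ.1 j).1 }) := by
    refine Nat.card_le_card_of_injective
      (fun μ => ⟨i μ.1 μ.2, μ.1, fun j => ?_⟩) fun μ ν h => ?_
    · by_cases hj : j = i μ.1 μ.2
      · subst hj
        simpa [S'] using hi' μ.1 μ.2
      · simp [S', hj]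
    · have := congrArg (fun x => x.2.1) h
      exact Subtype.ext this
  rw [Nat.card_sigma] at hinj
  calc (Nat.card { μ // P μ } : ℝ) ≤ ∑ i, (Nat.card { μ : Multipartition k N //
        ∀ j, (μ.1 j).2 ∈ S' i j (μ.1 j).1 } : ℝ) := by exact_mod_cast hinj
    _ ≤ ∑ _i : Fin k, ε * Nat.card (Multipartition k N) := Finset.sum_le_sum fun i _ => hi i
    _ = _ := by simp

lemma Multipartition.exists_le_component {k N : ℕ} (hk : 1 ≤ k) (μ : Multipartition k N) :
    ∃ i, (N : ℝ) / k ≤ (μ.1 i).1 := by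
  have hk0 : (0 : ℝ) < k := by exact_mod_cast hk
  have : Nonempty (Fin k) := ⟨⟨0, hk⟩⟩
  obtain ⟨i, -, hi⟩ := Finset.exists_le_of_sum_le (s := (Finset.univ : Finset (Fin k)))
    (f := fun _ => (N : ℝ) / k) (g := fun i => ((μ.1 i).1 : ℝ)) Finset.univ_nonempty (by
      rw [← Nat.cast_sum, μ.2]
      simp [mul_div_cancel₀ _ hk0.ne'])
  exact ⟨i, hi⟩

/-- Fix a prime `p` and `k ≥ 1`.  For all but
`O(exp(−(N/k)^{1/(15p)}) · p_k(N))` of the `k`-multipartitions `μ` of `N`, the fully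
mashed multipartition `μ̃` (obtained by repeatedly replacing `p` equal parts `m` by one
part `mp` until no part appears `p` or more times) has largest part at least
`(√6/(2π)) √(N/k) log(N/k) (1 + 1/(5p))`. -/
theorem mashed_large_part (p : ℕ) (hp : p.Prime) (k : ℕ) (hk : 1 ≤ k) :
    ∃ C : ℝ, 0 < C ∧ ∀ N : ℕ,
      (Nat.card { μ : Multipartition k N //
          ¬ ∀ ν : Fin k → Multiset ℕ,
              Relation.ReflTransGen (MergeStep p) (fun i => (μ.1 i).2.parts) ν →
              FullyMashed p ν →
              Real.sqrt 6 / (2 * π) * Real.sqrt ((N : ℝ) / k) * Real.log ((N : ℝ) / k) *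
                  (1 + 1 / (5 * p)) ≤ (maxPart ν : ℝ) } : ℝ) ≤
        C * Real.exp (-(((N : ℝ) / k) ^ ((1 : ℝ) / (15 * p)))) *
          (Nat.card (Multipartition k N) : ℝ) := by
  classical
  have hk0 : (0 : ℝ) < k := by exact_mod_cast hk
  obtain ⟨C, hC, hbound⟩ := exists_card_powSum_lt_threshold_le hp.two_le
  refine ⟨k * C, by positivity, fun N => ?_⟩
  set x : ℝ := (N : ℝ) / k with hx
  have hx0 : 0 ≤ x := by positivity
  set ε := C * exp (-(x ^ ((1 : ℝ) / (15 * p)))) with hε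
  let S : ∀ n : ℕ, Finset n.Partition := fun n => Finset.univ.filter fun l => x ≤ n ∧
    ∀ m J : ℕ, 0 < m → threshold p n ≤ m * p ^ J → powSum p m l.parts < m * p ^ J
  rw [mul_assoc (k : ℝ) C, ← hε, mul_assoc (k : ℝ) ε]
  refine card_le_of_exists_component S (fun n => ?_) _ fun μ hμ => ?_
  · by_cases hn : x ≤ n
    · refine (hbound n (S n) fun l hl => (Finset.mem_filter.1 hl).2.2).trans ?_
      rw [hε]
      gcongr
    · have : S n = ∅ := Finset.filter_eq_empty_iff.2 fun l _ h => hn h.1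
      rw [this]
      simp only [Finset.card_empty, Nat.cast_zero]
      positivity
  · push Not at hμ
    obtain ⟨ν, hν, hmash, hlt⟩ := hμ
    change (maxPart ν : ℝ) < threshold p x at hlt
    have hx1 : 1 ≤ x := by
      by_contra! h
      linarith [threshold_nonpos (p := p) hx0 h.le, Nat.cast_nonneg (α := ℝ) (maxPart ν)]
    obtain ⟨i, hi⟩ := μ.exists_le_component hk
    refine ⟨i, Finset.mem_filter.2 ⟨Finset.mem_univ _, hi, fun m J hm hJ => ?_⟩⟩
    refine (powSum_le_of_reflTransGen hν m i).trans_lt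
      (powSum_lt_of_count_lt hp.two_le hm (hmash i) fun q hq => ?_)
    have h1 : q ≤ maxPart ν := (Multiset.le_sup hq).trans
      (Finset.le_sup (f := fun i => (ν i).sup) (Finset.mem_univ i))
    have h2 : (maxPart ν : ℝ) < m * p ^ J :=
      hlt.trans_le ((threshold_mono hx1 hi).trans hJ)
    exact h1.trans_lt (by exact_mod_cast h2)
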